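/- Let S(t) = X₁²(t) + X₂²(t) where X₁, X₂ are the independent Gaussian processes with covariances Cov(X₁(s),X₁(t)) = ((s∧t)(1−(s∨t)))/((s∨t)(1−(s∧t))) and Cov(X₂(s),X₂(t)) = ((s∧t)(1−(s∨t)))/√((s∧t)(1−(s∧t))(s∨t)(1−(s∨t))). Then for 0 < T₁ < T₂ < 1, as u → ∞, P(sup_{t ∈ [T₁,T₂] ∩ u^{−1}ℤ} S(t) > u) ∼ (u e^{−u/2}/(2π)) ∫_{v₁²+v₂²=1} ∫_{T₁}^{T₂} H₁¹((v₁² + ½v₂²)/(t(1−t))) dt dv, where H₁¹(a) = lim_{S→∞}(1/S)E[sup_{t∈[0,S]∩ℤ} exp(√(2a)B₁(t) − a t)] with B₁ standard Brownian motion (rescaled so Var B₁(t) = t... Hurst index 1/2, α = 1). -/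

import Mathlib

open MeasureTheory ProbabilityTheory Filter Real

/-- Increments of a sequence, with the initial value as zeroth increment. -/
def incr (s : ℕ → ℝ) : ℕ → ℝ
  | 0 => s 0
  | l + 1 => s (l + 1) - s l

lemma sum_incr (s : ℕ → ℝ) (j : ℕ) : ∑ l ∈ Finset.range (j + 1), incr s l = s j := by
  induction j with
  | zero => simp [incr]
  | succ k ih => rw [Finset.sum_range_succ, ih]; simp [incr]

section GaussianVectors

variable {Ω : Type*} [MeasurableSpace Ω] {μ : Measure Ω}

/-- All linear combinations of the process are centered Gaussian. -/
def CenteredGaussian (μ : Measure Ω) (Y : ℝ → Ω → ℝ) : Prop :=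
  ∀ (m : ℕ) (c : Fin m → ℝ) (t : Fin m → ℝ), ∃ v : NNReal,
    μ.map (fun ω => ∑ j, c j * Y (t j) ω) = gaussianReal 0 v

lemma CenteredGaussian.map_eval {Y : ℝ → Ω → ℝ} (hY : CenteredGaussian μ Y) (t : ℝ) :
    ∃ v : NNReal, μ.map (Y t) = gaussianReal 0 v := by
  simpa using hY 1 1 (fun _ => t)

lemma CenteredGaussian.aemeasurable {Y : ℝ → Ω → ℝ} (hY : CenteredGaussian μ Y) (t : ℝ) :
    AEMeasurable (Y t) μ := by
  obtain ⟨v, hv⟩ := hY.map_eval t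
  have : NeZero (μ.map (Y t)) := by rw [hv]; infer_instance
  exact aemeasurable_of_map_neZero this

lemma CenteredGaussian.integral_eq_zero {Y : ℝ → Ω → ℝ} (hY : CenteredGaussian μ Y) (t : ℝ) :
    ∫ ω, Y t ω ∂μ = 0 := by
  obtain ⟨v, hv⟩ := hY.map_eval t
  have h := integral_map (hY.aemeasurable t) (f := fun x : ℝ => x) (by fun_prop)
  rw [← h, hv, integral_id_gaussianReal]

lemma CenteredGaussian.hasGaussianLaw {Y : ℝ → Ω → ℝ} (hY : CenteredGaussian μ Y)
    {n : ℕ} (t : Fin n → ℝ) : HasGaussianLaw (fun ω j => Y (t j) ω) μ := by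
  refine ⟨isGaussian_of_map_eq_gaussianReal fun L => ?_⟩
  obtain ⟨v, hv⟩ := hY n (fun j => L (Pi.single j 1)) t
  refine ⟨0, v, ?_⟩
  rw [← hv, AEMeasurable.map_map_of_aemeasurable (by fun_prop)
    (aemeasurable_pi_lambda _ fun j => hY.aemeasurable _)]
  congr 1
  ext ω
  simp only [Function.comp]
  conv_lhs => rw [show (fun j => Y (t j) ω) = ∑ j, Y (t j) ω • (Pi.single j (1 : ℝ) : Fin n → ℝ)
    from by ext i; simp [Finset.sum_apply, Pi.single_apply]]
  simp [map_sum, mul_comm]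

lemma CenteredGaussian.memLp {Y : ℝ → Ω → ℝ} (hY : CenteredGaussian μ Y) (t : ℝ) :
    MemLp (Y t) 2 μ :=
  ((hY.hasGaussianLaw (n := 1) (fun _ => t)).eval 0).memLp_two

lemma map_eq_pi_gaussianReal [IsProbabilityMeasure μ] {n : ℕ} (V : Fin n → Ω → ℝ)
    (hV : HasGaussianLaw (fun ω i => V i ω) μ) (h0 : ∀ i, ∫ ω, V i ω ∂μ = 0)
    (hcov : ∀ i j, ∫ ω, V i ω * V j ω ∂μ = if i = j then 1 else 0) :
    μ.map (fun ω i => V i ω) = Measure.pi fun _ => gaussianReal 0 1 := by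
  have hm : ∀ i, MemLp (V i) 2 μ := fun i => (hV.eval i).memLp_two
  have hc : ∀ i j, cov[V i, V j; μ] = if i = j then 1 else 0 := by
    intro i j
    rw [covariance_eq_sub (hm i) (hm j), h0, h0, ← hcov i j]
    simp
  have hind : iIndepFun V μ := hV.iIndepFun_of_covariance_eq_zero fun i j hij => by
    rw [hc, if_neg hij]
  rw [(iIndepFun_iff_map_fun_eq_pi_map fun i => (hV.eval i).aemeasurable).1 hind]
  congr 1
  ext1 i
  rw [(hV.eval i).map_eq_gaussianReal, h0 i, ← covariance_self (hV.eval i).aemeasurable, hc]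
  simp

/-- The normalised increments of a Gaussian sequence with covariance `s (min i j)` are
independent standard Gaussian variables. -/
theorem CenteredGaussian.map_incr [IsProbabilityMeasure μ] {Y : ℝ → Ω → ℝ}
    (hY : CenteredGaussian μ Y) (n : ℕ) (t f s : ℕ → ℝ)
    (hcov : ∀ i j, i ≤ j → j < n → (∫ ω, Y (t i) ω * Y (t j) ω ∂μ) * (f i * f j) = s i)
    (hs : ∀ l < n, 0 < incr s l) :
    μ.map (fun ω (l : Fin n) => incr (fun i => f i * Y (t i) ω) l / √(incr s l)) =
      Measure.pi fun _ => gaussianReal 0 1 := by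
  have hN : ∀ i, MemLp (fun ω => f i * Y (t i) ω) 2 μ := fun i => (hY.memLp _).const_mul _
  have hcov' : ∀ i j, i < n → j < n →
      ∫ ω, (f i * Y (t i) ω) * (f j * Y (t j) ω) ∂μ = s (min i j) := by
    intro i j hi hj
    rcases le_total i j with h | h
    · rw [min_eq_left h, ← hcov i j h hj, ← integral_mul_const]
      congr 1; ext ω; ring
    · rw [min_eq_right h, ← hcov j i h hi, ← integral_mul_const]
      congr 1; ext ω; ring
  have hcI : ∀ i j, i < n → j < n →
      ∫ ω, incr (fun i => f i * Y (t i) ω) i * incr (fun i => f i * Y (t i) ω) j ∂μ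
        = if i = j then incr s i else 0 := by
    have hint : ∀ i j, Integrable (fun ω => (f i * Y (t i) ω) * (f j * Y (t j) ω)) μ :=
      fun i j => (hN i).integrable_mul (hN j)
    have hI : ∀ i j k l, i < n → j < n → k < n → l < n →
        ∫ ω, (f i * Y (t i) ω - f j * Y (t j) ω) * (f k * Y (t k) ω - f l * Y (t l) ω) ∂μ =
        s (min i k) - s (min i l) - s (min j k) + s (min j l) := by
      intro i j k l hi hj hk hl
      rw [← hcov' i k hi hk, ← hcov' i l hi hl, ← hcov' j k hj hk, ← hcov' j l hj hl,
        ← integral_sub (hint _ _) (hint _ _), ← integral_sub (by fun_prop) (hint _ _),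
        ← integral_add (by fun_prop) (hint _ _)]
      congr 1; ext ω; ring
    have hI' : ∀ i k l, i < n → k < n → l < n →
        ∫ ω, (f i * Y (t i) ω) * (f k * Y (t k) ω - f l * Y (t l) ω) ∂μ =
        s (min i k) - s (min i l) := by
      intro i k l hi hk hl
      rw [← hcov' i k hi hk, ← hcov' i l hi hl, ← integral_sub (hint _ _) (hint _ _)]
      congr 1; ext ω; ring
    intro i j hi hj
    rcases i with _ | i <;> rcases j with _ | j
    · simpa [incr] using hcov' 0 0 hi hj
    · simp only [incr]
      rw [hI' 0 (j + 1) j hi hj (by lia)]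
      simp
    · simp only [incr]
      simp_rw [mul_comm (_ - _) (_ : ℝ)]
      rw [hI' 0 (i + 1) i hj hi (by lia)]
      simp
    · simp only [incr]
      rw [hI (i + 1) i (j + 1) j hi (by lia) hj (by lia)]
      rcases lt_trichotomy i j with h | h | h
      · rw [min_eq_left (by lia), min_eq_left (by lia), min_eq_left (by lia),
          min_eq_left (by lia), if_neg (by lia)]
        ring
      · subst h
        simp
      · rw [min_eq_right (by lia), min_eq_right (by lia), min_eq_right (by lia),
          min_eq_right (by lia), if_neg (by lia)]
        ring
  refine map_eq_pi_gaussianReal _ ?_ ?_ ?_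
  · have hG := hY.hasGaussianLaw (fun i : Fin n => t i)
    let L : (Fin n → ℝ) →ₗ[ℝ] (Fin n → ℝ) :=
      { toFun := fun y l =>
          incr (fun i => f i * (if h : i < n then y ⟨i, h⟩ else 0)) l / √(incr s l)
        map_add' := by
          intro x y
          ext l
          obtain ⟨l, hl⟩ := l
          rcases l with _ | l
          · simp [incr, hl]; ring
          · simp [incr, hl, show l < n by lia]; ring
        map_smul' := by
          intro c y
          ext l
          obtain ⟨l, hl⟩ := l
          rcases l with _ | l
          · simp [incr, hl]; ring
          · simp [incr, hl, show l < n by lia]; ring }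
    have h2 := hG.map_fun (LinearMap.toContinuousLinearMap L)
    refine h2.congr (ae_of_all _ fun ω => ?_)
    refine funext fun l => ?_
    obtain ⟨l, hl⟩ := l
    rcases l with _ | l
    · simp [incr, hl, L]
    · simp [incr, hl, L, show l < n by lia]
  · rintro ⟨l, hl⟩
    have hz : ∀ i, ∫ ω, f i * Y (t i) ω ∂μ = 0 := fun i => by
      rw [integral_const_mul, hY.integral_eq_zero, mul_zero]
    have hNi : ∀ i, Integrable (fun ω => f i * Y (t i) ω) μ := fun i =>
      (hN i).integrable (by norm_num)
    rcases l with _ | l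
    · simp only [incr]
      rw [integral_div, hz, zero_div]
    · simp only [incr]
      rw [integral_div, integral_sub (hNi _) (hNi _), hz, hz]; simp
  · intro i j
    have h1 := hcI i j i.2 j.2
    have : ∀ ω, incr (fun i => f i * Y (t i) ω) i / √(incr s i) *
        (incr (fun i => f i * Y (t i) ω) j / √(incr s j)) =
        incr (fun i => f i * Y (t i) ω) i * incr (fun i => f i * Y (t i) ω) j /
          (√(incr s i) * √(incr s j)) := fun ω => by rw [div_mul_div_comm]
    simp_rw [this]
    rw [integral_div, h1]
    by_cases hij : i = j
    · subst hij
      have := hs i i.2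
      simp [Real.mul_self_sqrt this.le, this.ne']
    · rw [if_neg (by simpa [Fin.ext_iff] using hij), if_neg hij, zero_div]

end GaussianVectors

/-- Sum of the first `j` coordinates of a finite vector. -/
def partialSum {m : ℕ} (z : Fin m → ℝ) (j : ℕ) : ℝ := ∑ l : Fin m, if (l : ℕ) < j then z l else 0

lemma partialSum_zero {m : ℕ} (z : Fin m → ℝ) : partialSum z 0 = 0 := by simp [partialSum]

lemma partialSum_succ {m : ℕ} (z : Fin (m + 1) → ℝ) (j : ℕ) :
    partialSum z (j + 1) = z 0 + partialSum (fun i => z i.succ) j := by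
  simp [partialSum, Fin.sum_univ_succ]

lemma partialSum_eq_range {m : ℕ} (v : ℕ → ℝ) {j : ℕ} (hj : j ≤ m) :
    partialSum (fun l : Fin m => v l) j = ∑ l ∈ Finset.range j, v l := by
  unfold partialSum
  rw [Fin.sum_univ_eq_sum_range (fun l => if l < j then v l else 0) m, ← Finset.sum_filter]
  congr 1
  ext l
  simp only [Finset.mem_filter, Finset.mem_range]
  lia

/-- Maximum over `0 ≤ j ≤ m` of the exponential martingale with parameter `b`. -/
noncomputable def walkMax (b : ℝ) : (m : ℕ) → (Fin m → ℝ) → ℝ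
  | 0, _ => 1
  | m + 1, z => max 1 (exp (√(2 * b) * z 0 - b) * walkMax b m fun i => z i.succ)

/-- Maximum over `1 ≤ j ≤ m + 1` of the exponential martingale with parameter `b`. -/
noncomputable def tailMax (b : ℝ) (m : ℕ) (z : Fin (m + 1) → ℝ) : ℝ :=
  exp (√(2 * b) * z 0 - b) * walkMax b m fun i => z i.succ

lemma walkMax_le_iff (b c : ℝ) (m : ℕ) (z : Fin m → ℝ) :
    walkMax b m z ≤ c ↔ ∀ j ≤ m, exp (√(2 * b) * partialSum z j - b * j) ≤ c := by
  induction m generalizing c with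
  | zero => simp [walkMax, partialSum]
  | succ m ih =>
    rw [walkMax, max_le_iff, mul_comm, ← le_div_iff₀ (exp_pos _), ih]
    have key : ∀ j : ℕ, exp (√(2 * b) * partialSum (fun i => z i.succ) j - b * j) ≤
        c / exp (√(2 * b) * z 0 - b) ↔
        exp (√(2 * b) * partialSum z (j + 1) - b * (j + 1 : ℕ)) ≤ c := by
      intro j
      rw [le_div_iff₀ (exp_pos _), ← exp_add, partialSum_succ]
      push_cast
      ring_nf
    constructor
    · rintro ⟨h1, h2⟩ j hj
      rcases j with _ | j
      · simpa [partialSum_zero] using h1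
      · exact (key j).1 (h2 j (by lia))
    · intro h
      refine ⟨by simpa [partialSum_zero] using h 0 (by lia), fun j hj => (key j).2 (h _ (by lia))⟩

lemma tailMax_le_iff (b c : ℝ) (m : ℕ) (z : Fin (m + 1) → ℝ) :
    tailMax b m z ≤ c ↔
      ∀ j ≤ m, exp (√(2 * b) * partialSum z (j + 1) - b * (j + 1 : ℕ)) ≤ c := by
  rw [tailMax, mul_comm, ← le_div_iff₀ (exp_pos _), walkMax_le_iff]
  refine forall₂_congr fun j _ => ?_
  rw [le_div_iff₀ (exp_pos _), ← exp_add, partialSum_succ]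
  push_cast
  ring_nf

lemma one_le_walkMax (b : ℝ) (m : ℕ) (z : Fin m → ℝ) : 1 ≤ walkMax b m z := by
  cases m <;> simp [walkMax]

lemma tailMax_pos (b : ℝ) (m : ℕ) (z : Fin (m + 1) → ℝ) : 0 < tailMax b m z :=
  mul_pos (exp_pos _) (zero_lt_one.trans_le (one_le_walkMax _ _ _))

lemma continuous_walkMax (m : ℕ) :
    Continuous fun p : ℝ × (Fin m → ℝ) => walkMax p.1 m p.2 := by
  induction m with
  | zero => simpa [walkMax] using continuous_const
  | succ m ih =>
    simp only [walkMax]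
    have h := ih.comp (f := fun p : ℝ × (Fin (m + 1) → ℝ) => (p.1, fun i => p.2 i.succ))
      (by fun_prop)
    simp only [Function.comp_def] at h
    fun_prop

lemma continuous_tailMax (m : ℕ) :
    Continuous fun p : ℝ × (Fin (m + 1) → ℝ) => tailMax p.1 m p.2 := by
  have h := (continuous_walkMax m).comp
    (f := fun p : ℝ × (Fin (m + 1) → ℝ) => (p.1, fun i => p.2 i.succ)) (by fun_prop)
  simp only [Function.comp_def] at h
  unfold tailMax
  fun_prop

/-- Law of `m` independent standard Gaussian variables. -/
noncomputable abbrev stdGauss (m : ℕ) : Measure (Fin m → ℝ) := Measure.pi fun _ => gaussianReal 0 1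

lemma integrable_exp_gauss (b : ℝ) :
    Integrable (fun x => exp (√(2 * b) * x - b)) (gaussianReal 0 1) := by
  simp_rw [sub_eq_add_neg, exp_add]
  exact (integrable_exp_mul_gaussianReal _).mul_const _

lemma integral_exp_gauss {b : ℝ} (hb : 0 ≤ b) :
    ∫ x, exp (√(2 * b) * x - b) ∂gaussianReal 0 1 = 1 := by
  have h := congrFun (mgf_id_gaussianReal (μ := 0) (v := 1)) (√(2 * b))
  rw [mgf] at h
  simp_rw [sub_eq_add_neg, exp_add]
  rw [integral_mul_const]
  simp only [id] at h
  rw [h, ← exp_add, sq_sqrt (by positivity)]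
  simp

lemma measurePreserving_cons (m : ℕ) :
    MeasurePreserving (fun z : Fin (m + 1) → ℝ => (z 0, fun i : Fin m => z i.succ))
      (stdGauss (m + 1)) ((gaussianReal 0 1).prod (stdGauss m)) := by
  have h := measurePreserving_piFinSuccAbove (fun _ : Fin (m + 1) => gaussianReal 0 1) 0
  exact h

lemma integrable_walkMax (b : ℝ) (m : ℕ) : Integrable (walkMax b m) (stdGauss m) := by
  induction m with
  | zero => exact integrable_const (1 : ℝ)
  | succ m ih =>
    have h := (measurePreserving_cons m).integrable_comp_of_integrable
      ((integrable_exp_gauss b).mul_prod ih)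
    exact (integrable_const (1 : ℝ)).sup h

lemma integrable_tailMax (b : ℝ) (m : ℕ) : Integrable (tailMax b m) (stdGauss (m + 1)) :=
  (measurePreserving_cons m).integrable_comp_of_integrable
    ((integrable_exp_gauss b).mul_prod (integrable_walkMax b m))

lemma integral_tailMax {b : ℝ} (hb : 0 ≤ b) (m : ℕ) :
    ∫ z, tailMax b m z ∂stdGauss (m + 1) = ∫ z, walkMax b m z ∂stdGauss m := by
  have h := (measurePreserving_piFinSuccAbove (fun _ : Fin (m + 1) => gaussianReal 0 1) 0
    ).integral_comp' (g := fun p : ℝ × (Fin m → ℝ) =>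
      exp (√(2 * b) * p.1 - b) * walkMax b m p.2)
  have h2 := integral_prod_mul (μ := gaussianReal 0 1) (ν := stdGauss m)
    (fun x => exp (√(2 * b) * x - b)) (walkMax b m)
  rw [integral_exp_gauss hb, one_mul] at h2
  exact h.trans h2

/-- Probability that an independent exponential variable plus the Gaussian random walk with
drift `-b` stays nonpositive at times `1, …, m + 1`. -/
noncomputable def stayProb (b : ℝ) (m : ℕ) : ℝ :=
  ∫ z, max 0 (1 - tailMax b m z) ∂stdGauss (m + 1)

lemma stayProb_eq {b : ℝ} (hb : 0 ≤ b) (m : ℕ) :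
    stayProb b m = ∫ z, walkMax b (m + 1) z ∂stdGauss (m + 1) -
      ∫ z, walkMax b m z ∂stdGauss m := by
  rw [← integral_tailMax hb m, ← integral_sub (integrable_walkMax _ _) (integrable_tailMax _ _)]
  refine integral_congr_ae (ae_of_all _ fun z => ?_)
  change max 0 (1 - tailMax b m z) = max 1 (tailMax b m z) - tailMax b m z
  rw [← max_sub_sub_right, sub_self, max_comm]

lemma sum_stayProb {b : ℝ} (hb : 0 ≤ b) (N : ℕ) :
    ∑ m ∈ Finset.range N, stayProb b m = ∫ z, walkMax b N z ∂stdGauss N - 1 := by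
  simp_rw [stayProb_eq hb]
  rw [Finset.sum_range_sub (fun m => ∫ z, walkMax b m z ∂stdGauss m)]
  simp [walkMax]

lemma stayProb_nonneg (b : ℝ) (m : ℕ) : 0 ≤ stayProb b m :=
  integral_nonneg fun _ => le_max_left _ _

lemma stayProb_integrand_le (b : ℝ) (m : ℕ) (z : Fin (m + 1) → ℝ) :
    max 0 (1 - tailMax b m z) ≤ 1 :=
  max_le zero_le_one (by linarith [tailMax_pos b m z])

lemma stayProb_le_one (b : ℝ) (m : ℕ) : stayProb b m ≤ 1 := by
  have h : ∫ z, max 0 (1 - tailMax b m z) ∂stdGauss (m + 1) ≤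
      ∫ z, (1 : ℝ) ∂stdGauss (m + 1) :=
    integral_mono_of_nonneg (ae_of_all _ fun _ => le_max_left _ _) (integrable_const _)
      (ae_of_all _ fun z => stayProb_integrand_le b m z)
  rw [integral_const, probReal_univ, one_smul] at h
  exact h

lemma measurable_stayProb (m : ℕ) : Measurable fun b => stayProb b m := by
  have h : StronglyMeasurable fun p : ℝ × (Fin (m + 1) → ℝ) => max 0 (1 - tailMax p.1 m p.2) :=
    (continuous_const.max (continuous_const.sub (continuous_tailMax m))).stronglyMeasurable
  exact (h.integral_prod_right (ν := stdGauss (m + 1))).measurable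

section Pickands

variable {Ω : Type*} [MeasurableSpace Ω] {μ : Measure Ω} [IsProbabilityMeasure μ]

lemma integral_sSup_brownian {B : ℝ → Ω → ℝ} (hB : CenteredGaussian μ B)
    (hcov : ∀ s t : ℝ, ∫ ω, B s ω * B t ω ∂μ = (|t| + |s| - |t - s|) / 2) (b : ℝ) (N : ℕ) :
    ∫ ω, sSup ((fun t : ℝ => exp (√(2 * b) * B t ω - b * |t|)) ''
      (Set.Icc 0 (N : ℝ) ∩ {x : ℝ | ∃ k : ℤ, x = (k : ℝ)})) ∂μ =
      ∫ z, walkMax b N z ∂stdGauss N := by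
  have hinc : ∀ l, incr (fun i : ℕ => (i : ℝ) + 1) l = 1 := by
    intro l; cases l <;> simp [incr]
  have hlaw := hB.map_incr N (fun i => (i : ℝ) + 1) (fun _ => 1) (fun i => (i : ℝ) + 1)
    (fun i j hij _ => by
      have : (i : ℝ) ≤ j := by exact_mod_cast hij
      rw [hcov, abs_of_nonneg (by positivity), abs_of_nonneg (by positivity),
        abs_of_nonneg (by linarith)]
      ring) (fun l _ => by rw [hinc]; exact one_pos)
  simp only [hinc, one_mul, sqrt_one, div_one] at hlaw
  have h0 : ∀ᵐ ω ∂μ, B 0 ω = 0 := by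
    have h := hcov 0 0
    have hint : Integrable (fun ω => B 0 ω * B 0 ω) μ := (hB.memLp 0).integrable_mul (hB.memLp 0)
    have h' : ∫ ω, B 0 ω * B 0 ω ∂μ = 0 := by rw [h]; simp
    rw [integral_eq_zero_iff_of_nonneg (fun ω => mul_self_nonneg _) hint] at h'
    filter_upwards [h'] with ω hω
    simpa using hω
  rw [stdGauss, ← hlaw, integral_map]
  · refine integral_congr_ae ?_
    filter_upwards [h0] with ω hω
    have hps : ∀ j ≤ N, partialSum
        (fun l : Fin N => incr (fun i => B ((i : ℝ) + 1) ω) l) j = B j ω := by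
      intro j hj
      rw [partialSum_eq_range (fun l => incr (fun i => B ((i : ℝ) + 1) ω) l) hj]
      rcases j with _ | j
      · simp [hω]
      · rw [sum_incr]; simp
    have hne : ((fun t : ℝ => exp (√(2 * b) * B t ω - b * |t|)) ''
      (Set.Icc 0 (N : ℝ) ∩ {x : ℝ | ∃ k : ℤ, x = (k : ℝ)})).Nonempty :=
      ⟨_, 0, ⟨⟨le_rfl, by positivity⟩, 0, by simp⟩, rfl⟩
    refine IsLUB.csSup_eq ?_ hne
    rw [isLUB_iff_le_iff]
    intro c
    rw [walkMax_le_iff, mem_upperBounds, Set.forall_mem_image]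
    constructor
    · rintro h t ⟨⟨ht0, htN⟩, k, rfl⟩
      obtain ⟨j, rfl⟩ : ∃ j : ℕ, k = j := ⟨k.toNat, by
        have : (0 : ℤ) ≤ k := by exact_mod_cast ht0
        lia⟩
      have hj : j ≤ N := by exact_mod_cast htN
      have := h j hj
      rw [hps j hj] at this
      simpa using this
    · intro h j hj
      rw [hps j hj]
      have := h (x := (j : ℝ)) ⟨⟨by positivity, by exact_mod_cast hj⟩, j, by simp⟩
      simpa using this
  · refine aemeasurable_pi_lambda _ fun l => ?_
    obtain ⟨l, hl⟩ := l
    rcases l with _ | l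
    · exact hB.aemeasurable _
    · exact (hB.aemeasurable _).sub (hB.aemeasurable _)
  · exact ((continuous_walkMax N).comp (f := fun z : Fin N → ℝ => (b, z))
      (by fun_prop)).aestronglyMeasurable

/-- The discrete Pickands constant is the Cesàro limit of the probabilities `stayProb`. -/
theorem tendsto_cesaro_stayProb {B : ℝ → Ω → ℝ} (hB : CenteredGaussian μ B)
    (hcov : ∀ s t : ℝ, ∫ ω, B s ω * B t ω ∂μ = (|t| + |s| - |t - s|) / 2) {b h : ℝ} (hb : 0 < b)
    (hh : Tendsto (fun S : ℝ => (∫ ω, sSup ((fun t : ℝ =>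
      exp (√(2 * b) * B t ω - b * |t|)) ''
      (Set.Icc 0 S ∩ {x : ℝ | ∃ k : ℤ, x = (k : ℝ)})) ∂μ) / S) atTop (nhds h)) :
    Tendsto (fun N : ℕ => (N : ℝ)⁻¹ * ∑ m ∈ Finset.range N, stayProb b m) atTop (nhds h) := by
  have h1 := (hh.comp (tendsto_natCast_atTop_atTop (R := ℝ))).sub
    (tendsto_inv_atTop_nhds_zero_nat (𝕜 := ℝ))
  rw [sub_zero] at h1
  refine h1.congr fun N => ?_
  simp only [Function.comp]
  rw [integral_sSup_brownian hB hcov, sum_stayProb hb.le]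
  ring

end Pickands

/-- The planar point with squared norm `u - 2 log w` and angle `φ`, where `p = (φ, w)`. -/
noncomputable def polarPt (u : ℝ) (p : ℝ × ℝ) : ℝ × ℝ :=
  (√(u - 2 * log p.2) * cos p.1, √(u - 2 * log p.2) * sin p.1)

/-- The parameter rectangle of `polarPt`. -/
def polarBox : Set (ℝ × ℝ) := Set.Ioo (-π) π ×ˢ Set.Ioo 0 1

lemma measurable_polarPt (u : ℝ) : Measurable (polarPt u) := by
  unfold polarPt; fun_prop

lemma image_sqrt_log {u : ℝ} (hu : 0 ≤ u) :
    (fun w => √(u - 2 * log w)) '' Set.Ioo 0 1 = Set.Ioi √u := by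
  ext r
  simp only [Set.mem_image, Set.mem_Ioo, Set.mem_Ioi]
  constructor
  · rintro ⟨w, ⟨h0, h1⟩, rfl⟩
    exact sqrt_lt_sqrt hu (by linarith [log_neg h0 h1])
  · intro hr
    have hr0 : 0 < r := (sqrt_nonneg _).trans_lt hr
    refine ⟨exp ((u - r ^ 2) / 2), ⟨exp_pos _, ?_⟩, ?_⟩
    · rw [exp_lt_one_iff]
      have := (sqrt_lt' hr0).1 hr
      linarith
    · rw [log_exp]
      rw [show u - 2 * ((u - r ^ 2) / 2) = r ^ 2 by ring, sqrt_sq hr0.le]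

lemma injOn_sqrt_log {u : ℝ} (hu : 0 ≤ u) :
    Set.InjOn (fun w => √(u - 2 * log w)) (Set.Ioo 0 1) := by
  rintro a ⟨ha0, ha1⟩ b ⟨hb0, hb1⟩ h
  have h1 := (sqrt_inj (by linarith [log_neg ha0 ha1]) (by linarith [log_neg hb0 hb1])).1 h
  exact log_injOn_pos ha0 hb0 (by linarith)

lemma lintegral_radial {u : ℝ} (hu : 0 ≤ u) (g : ℝ → ENNReal) :
    ∫⁻ r in Set.Ioi √u, ENNReal.ofReal (r * exp (-r ^ 2 / 2)) * g r =
      ENNReal.ofReal (exp (-u / 2)) * ∫⁻ w in Set.Ioo (0 : ℝ) 1, g √(u - 2 * log w) := by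
  rw [← image_sqrt_log hu, lintegral_image_eq_lintegral_abs_deriv_mul measurableSet_Ioo
    (f' := fun w => (-(2 * w⁻¹)) / (2 * √(u - 2 * log w))) _ (injOn_sqrt_log hu)]
  · rw [← lintegral_const_mul' _ _ ENNReal.ofReal_ne_top]
    refine setLIntegral_congr_fun measurableSet_Ioo fun w hw => ?_
    have hl := log_neg hw.1 hw.2
    have hpos : 0 < u - 2 * log w := by linarith
    have hs := sqrt_pos.2 hpos
    have hw0 := hw.1
    rw [← mul_assoc, ← ENNReal.ofReal_mul (abs_nonneg _)]
    congr 2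
    rw [sq_sqrt hpos.le, show -(u - 2 * log w) / 2 = -u / 2 + log w by ring, exp_add,
      exp_log hw.1, abs_div, abs_neg, abs_of_pos (by positivity), abs_of_pos (by positivity)]
    field_simp
  · intro w hw
    have hl := log_neg hw.1 hw.2
    have hpos : 0 < u - 2 * log w := by linarith
    refine HasDerivAt.hasDerivWithinAt ?_
    have := (((hasDerivAt_log hw.1.ne').const_mul 2).const_sub u).sqrt hpos.ne'
    exact this

/-- Polar coordinates for the standard planar Gaussian law outside the disc of squared
radius `u`. -/
theorem lintegral_gaussian_polar {u : ℝ} (hu : 0 ≤ u) {f : ℝ × ℝ → ENNReal} (hf : Measurable f) :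
    ∫⁻ x, {x : ℝ × ℝ | u < x.1 ^ 2 + x.2 ^ 2}.indicator f x
        ∂((gaussianReal 0 1).prod (gaussianReal 0 1)) =
      ENNReal.ofReal (exp (-u / 2) / (2 * π)) * ∫⁻ p in polarBox, f (polarPt u p) := by
  have hS : MeasurableSet {x : ℝ × ℝ | u < x.1 ^ 2 + x.2 ^ 2} :=
    measurableSet_lt (by fun_prop) (by fun_prop)
  have hfi := hf.indicator hS
  rw [gaussianReal_of_var_ne_zero _ one_ne_zero, prod_withDensity (by fun_prop) (by fun_prop),
    lintegral_withDensity_eq_lintegral_mul _ (by fun_prop) hfi, ← Measure.volume_eq_prod,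
    ← lintegral_comp_polarCoord_symm, polarCoord_target, Measure.volume_eq_prod,
    polarBox, setLIntegral_prod_symm _ (by
      refine Measurable.aemeasurable ?_
      simp only [smul_eq_mul, Pi.mul_apply, polarCoord_symm_apply]
      have hp : Measurable fun p : ℝ × ℝ => (p.1 * cos p.2, p.1 * sin p.2) := by fun_prop
      have h1 := hfi.comp hp
      simp only [Function.comp_def] at h1
      fun_prop),
    setLIntegral_prod _ (by
      exact (hf.comp (measurable_polarPt u)).aemeasurable),
    ← lintegral_const_mul' _ _ ENNReal.ofReal_ne_top]
  refine setLIntegral_congr_fun measurableSet_Ioo fun φ _ => ?_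
  have key : ∀ r ∈ Set.Ioi (0 : ℝ), ENNReal.ofReal r • ((fun z : ℝ × ℝ =>
      gaussianPDF 0 1 z.1 * gaussianPDF 0 1 z.2) *
      {x : ℝ × ℝ | u < x.1 ^ 2 + x.2 ^ 2}.indicator f) (polarCoord.symm (r, φ)) =
      ENNReal.ofReal (1 / (2 * π)) * (Set.Ioi √u).indicator (fun r =>
        ENNReal.ofReal (r * exp (-r ^ 2 / 2)) * f (r * cos φ, r * sin φ)) r := by
    intro r hr
    have hr0 : 0 < r := hr
    have hsq : (r * cos φ) ^ 2 + (r * sin φ) ^ 2 = r ^ 2 := by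
      rw [mul_pow, mul_pow, ← mul_add, cos_sq_add_sin_sq, mul_one]
    simp only [smul_eq_mul, Pi.mul_apply, polarCoord_symm_apply]
    by_cases h : √u < r
    · have h' : u < r ^ 2 := (sqrt_lt' hr0).1 h
      rw [Set.indicator_of_mem (by simpa [hsq] using h'), Set.indicator_of_mem (Set.mem_Ioi.2 h),
        gaussianPDF, gaussianPDF, ← ENNReal.ofReal_mul (gaussianPDFReal_nonneg _ _ _),
        ← mul_assoc, ← mul_assoc, ← ENNReal.ofReal_mul hr0.le,
        ← ENNReal.ofReal_mul (by positivity)]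
      congr 2
      simp only [gaussianPDFReal_def, NNReal.coe_one, mul_one, sub_zero]
      rw [show -r ^ 2 / 2 = -(r * cos φ) ^ 2 / 2 + -(r * sin φ) ^ 2 / 2 by rw [← hsq]; ring,
        exp_add]
      have h2 : (√(2 * π))⁻¹ * (√(2 * π))⁻¹ = 1 / (2 * π) := by
        rw [← mul_inv, mul_self_sqrt (by positivity), one_div]
      linear_combination (r * exp (-(r * cos φ) ^ 2 / 2) * exp (-(r * sin φ) ^ 2 / 2)) * h2
    · have h' : ¬ u < r ^ 2 := fun hc => h ((sqrt_lt' hr0).2 hc)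
      rw [Set.indicator_of_notMem (by simpa [hsq] using h'),
        Set.indicator_of_notMem (Set.mem_Ioi.not.2 h)]
      simp
  rw [setLIntegral_congr_fun measurableSet_Ioi key, lintegral_const_mul' _ _ ENNReal.ofReal_ne_top,
    lintegral_indicator measurableSet_Ioi, Measure.restrict_restrict measurableSet_Ioi,
    Set.inter_eq_left.2 (Set.Ioi_subset_Ioi (sqrt_nonneg u)),
    lintegral_radial hu (fun r => f (r * cos φ, r * sin φ)), ← mul_assoc,
    ← ENNReal.ofReal_mul (by positivity)]
  congr 2
  ring

lemma gaussian_norm_sq_tail {u : ℝ} (hu : 0 ≤ u) :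
    ((gaussianReal 0 1).prod (gaussianReal 0 1)) {x : ℝ × ℝ | u < x.1 ^ 2 + x.2 ^ 2} =
      ENNReal.ofReal (exp (-u / 2)) := by
  have hS : MeasurableSet {x : ℝ × ℝ | u < x.1 ^ 2 + x.2 ^ 2} :=
    measurableSet_lt (by fun_prop) (by fun_prop)
  have h := lintegral_gaussian_polar hu (f := fun _ => 1) measurable_const
  rw [lintegral_indicator hS] at h
  simp only [lintegral_const, one_mul, Measure.restrict_apply MeasurableSet.univ,
    Set.univ_inter] at h
  rw [h, polarBox, Measure.volume_eq_prod, Measure.prod_prod, Real.volume_Ioo, Real.volume_Ioo,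
    ← ENNReal.ofReal_mul (by linarith [pi_pos]), ← ENNReal.ofReal_mul (by positivity)]
  congr 1
  field_simp
  ring

section TimeChange

variable {Ω : Type*} [MeasurableSpace Ω] {μ : Measure Ω}

/-- A centered Gaussian process on `(0, 1)` distributed as `W (h t) / √(h t)` for a Brownian
motion `W` and an increasing time change `h`. -/
structure IsTimeChangedBM (μ : Measure Ω) (X : ℝ → Ω → ℝ) (h : ℝ → ℝ) : Prop where
  gauss : CenteredGaussian μ X
  meas : ∀ t, Measurable (X t)
  pos : ∀ t ∈ Set.Ioo (0 : ℝ) 1, 0 < h t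
  mono : StrictMonoOn h (Set.Ioo 0 1)
  cov : ∀ s ∈ Set.Ioo (0 : ℝ) 1, ∀ t ∈ Set.Ioo (0 : ℝ) 1, s ≤ t →
    (∫ ω, X s ω * X t ω ∂μ) * (√(h s) * √(h t)) = h s

/-- The value at `s + j / u` of the process with time change `h`, in terms of its value `x`
at `s` and independent standard Gaussian innovations `z`. -/
noncomputable def arPos (h : ℝ → ℝ) (u s : ℝ) {M : ℕ} (x : ℝ) (z : Fin M → ℝ) (j : ℕ) : ℝ :=
  (√(h s) * x + partialSum (fun l => √(h (s + (l + 1 : ℕ) / u) - h (s + (l : ℕ) / u)) * z l) j) /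
    √(h (s + j / u))

/-- Standardised innovations of a time changed Brownian motion. -/
noncomputable def innov (h : ℝ → ℝ) (u s : ℝ) (M : ℕ) (y : ℝ → ℝ) (l : Fin M) : ℝ :=
  incr (fun i => √(h (s + i / u)) * y (s + i / u)) l / √(incr (fun i => h (s + i / u)) l)

lemma grid_mem {u s : ℝ} (hu : 0 < u) (hs : 0 < s) {M : ℕ} (hM : s + M / u < 1) {j : ℕ}
    (hj : j ≤ M) : s + j / u ∈ Set.Ioo (0 : ℝ) 1 := by
  have : (j : ℝ) / u ≤ M / u := by gcongr
  exact ⟨by positivity, by linarith⟩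

lemma IsTimeChangedBM.incr_pos {X : ℝ → Ω → ℝ} {h : ℝ → ℝ} (hX : IsTimeChangedBM μ X h)
    {u s : ℝ} (hu : 0 < u) (hs : 0 < s) {M : ℕ} (hM : s + M / u < 1) {l : ℕ} (hl : l < M + 1) :
    0 < incr (fun i => h (s + i / u)) l := by
  rcases l with _ | l
  · exact hX.pos _ (grid_mem hu hs hM (by lia))
  · simp only [incr]
    refine sub_pos.2 (hX.mono (grid_mem hu hs hM (by lia)) (grid_mem hu hs hM (by lia)) ?_)
    gcongr
    lia

lemma IsTimeChangedBM.map_innov [IsProbabilityMeasure μ] {X : ℝ → Ω → ℝ} {h : ℝ → ℝ}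
    (hX : IsTimeChangedBM μ X h) {u s : ℝ} (hu : 0 < u) (hs : 0 < s) {M : ℕ}
    (hM : s + M / u < 1) :
    μ.map (fun ω => innov h u s (M + 1) fun t => X t ω) = stdGauss (M + 1) := by
  refine hX.gauss.map_incr (M + 1) (fun i => s + i / u) (fun i => √(h (s + i / u)))
    (fun i => h (s + i / u)) (fun i j hij hj => ?_) (fun l hl => hX.incr_pos hu hs hM hl)
  refine hX.cov _ (grid_mem hu hs hM (by lia)) _ (grid_mem hu hs hM (by lia)) ?_
  gcongr

lemma measurable_innov (h : ℝ → ℝ) (u s : ℝ) (M : ℕ) : Measurable (innov h u s M) := by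
  refine measurable_pi_lambda _ fun l => ?_
  obtain ⟨l, hl⟩ := l
  rcases l with _ | l <;> simp only [innov, incr] <;> fun_prop

lemma IsTimeChangedBM.arPos_innov {X : ℝ → Ω → ℝ} {h : ℝ → ℝ} (hX : IsTimeChangedBM μ X h)
    {u s : ℝ} (hu : 0 < u) (hs : 0 < s) {M : ℕ} (hM : s + M / u < 1) {j : ℕ} (hj : j ≤ M)
    (y : ℝ → ℝ) :
    arPos h u s (innov h u s (M + 1) y 0) (fun i : Fin M => innov h u s (M + 1) y i.succ) j =
      y (s + j / u) := by
  have hpos := sqrt_pos.2 (hX.pos _ (grid_mem hu hs hM hj))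
  have hI : ∀ l < M + 1, √(incr (fun i => h (s + i / u)) l) *
      (incr (fun i => √(h (s + i / u)) * y (s + i / u)) l /
        √(incr (fun i => h (s + i / u)) l)) =
      incr (fun i => √(h (s + i / u)) * y (s + i / u)) l := fun l hl =>
    mul_div_cancel₀ _ (sqrt_pos.2 (hX.incr_pos hu hs hM hl)).ne'
  rw [arPos, div_eq_iff hpos.ne', mul_comm (y _),
    ← sum_incr (fun i => √(h (s + i / u)) * y (s + i / u)) j, Finset.sum_range_succ', add_comm]
  congr 1
  · rw [← partialSum_eq_range _ hj]
    congr 1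
    ext l
    exact hI (l + 1) (by lia)
  · have := hI 0 (by lia)
    simpa [innov, incr] using this

lemma measurePreserving_prodComm {α β γ δ : Type*} [MeasurableSpace α] [MeasurableSpace β]
    [MeasurableSpace γ] [MeasurableSpace δ] (a : Measure α) (b : Measure β) (c : Measure γ)
    (d : Measure δ) [SFinite a] [SFinite b] [SFinite c] [SFinite d] :
    MeasurePreserving (fun p : (α × β) × (γ × δ) => ((p.1.1, p.2.1), (p.1.2, p.2.2)))
      ((a.prod b).prod (c.prod d)) ((a.prod c).prod (b.prod d)) := by
  have h1 := measurePreserving_prodAssoc a b (c.prod d)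
  have h2 := (measurePreserving_prodAssoc b c d).symm
  have h3 := (Measure.measurePreserving_swap (μ := b) (ν := c)).prod (MeasurePreserving.id d)
  have h4 := measurePreserving_prodAssoc c b d
  have h5 := (MeasurePreserving.id a).prod (h4.comp (h3.comp h2))
  have h6 := (measurePreserving_prodAssoc a c (b.prod d)).symm
  exact h6.comp (h5.comp h1)

/-- Joint law of starting values and innovations of two independent processes. -/
lemma measurePreserving_innov [IsProbabilityMeasure μ] {X₁ X₂ : ℝ → Ω → ℝ} {h₁ h₂ : ℝ → ℝ}
    (hX₁ : IsTimeChangedBM μ X₁ h₁) (hX₂ : IsTimeChangedBM μ X₂ h₂)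
    (hind : IndepFun (fun ω t => X₁ t ω) (fun ω t => X₂ t ω) μ)
    {u s : ℝ} (hu : 0 < u) (hs : 0 < s) {M : ℕ} (hM : s + M / u < 1) :
    MeasurePreserving (fun ω =>
      ((innov h₁ u s (M + 1) (fun t => X₁ t ω) 0, innov h₂ u s (M + 1) (fun t => X₂ t ω) 0),
        ((fun i : Fin M => innov h₁ u s (M + 1) (fun t => X₁ t ω) i.succ),
          (fun i : Fin M => innov h₂ u s (M + 1) (fun t => X₂ t ω) i.succ))))
      μ (((gaussianReal 0 1).prod (gaussianReal 0 1)).prod ((stdGauss M).prod (stdGauss M))) := by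
  have m₁ : Measurable fun ω => innov h₁ u s (M + 1) fun t => X₁ t ω :=
    (measurable_innov _ _ _ _).comp (measurable_pi_lambda _ hX₁.meas)
  have m₂ : Measurable fun ω => innov h₂ u s (M + 1) fun t => X₂ t ω :=
    (measurable_innov _ _ _ _).comp (measurable_pi_lambda _ hX₂.meas)
  have hI : IndepFun (fun ω => innov h₁ u s (M + 1) fun t => X₁ t ω)
      (fun ω => innov h₂ u s (M + 1) fun t => X₂ t ω) μ :=
    hind.comp (measurable_innov h₁ u s (M + 1)) (measurable_innov h₂ u s (M + 1))
  have h0 : MeasurePreserving (fun ω => (innov h₁ u s (M + 1) (fun t => X₁ t ω),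
      innov h₂ u s (M + 1) (fun t => X₂ t ω))) μ ((stdGauss (M + 1)).prod (stdGauss (M + 1))) := by
    refine ⟨m₁.prodMk m₂, ?_⟩
    rw [(indepFun_iff_map_prod_eq_prod_map_map m₁.aemeasurable m₂.aemeasurable).1 hI,
      hX₁.map_innov hu hs hM, hX₂.map_innov hu hs hM]
  exact (measurePreserving_prodComm _ _ _ _).comp
    (((measurePreserving_cons M).prod (measurePreserving_cons M)).comp h0)


/-- The two-dimensional autoregression stays in the disc of squared radius `u` at the
first `m + 1` steps. -/
def staySet (h₁ h₂ : ℝ → ℝ) (u s : ℝ) (m : ℕ) :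
    Set ((ℝ × ℝ) × ((Fin (m + 1) → ℝ) × (Fin (m + 1) → ℝ))) :=
  {q | ∀ j ≤ m, arPos h₁ u s q.1.1 q.2.1 (j + 1) ^ 2 + arPos h₂ u s q.1.2 q.2.2 (j + 1) ^ 2 ≤ u}

lemma continuous_arPos (h : ℝ → ℝ) (u s : ℝ) (M j : ℕ) :
    Continuous fun p : ℝ × (Fin M → ℝ) => arPos h u s p.1 p.2 j := by
  unfold arPos partialSum
  refine Continuous.div_const (Continuous.add (by fun_prop)
    (continuous_finsetSum _ fun l _ => ?_)) _
  split_ifs <;> fun_prop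

lemma measurableSet_staySet (h₁ h₂ : ℝ → ℝ) (u s : ℝ) (m : ℕ) :
    MeasurableSet (staySet h₁ h₂ u s m) := by
  simp only [staySet, Set.ofPred_forall]
  refine MeasurableSet.iInter fun j => MeasurableSet.iInter fun _ =>
    measurableSet_le (Continuous.measurable ?_) measurable_const
  exact (((continuous_arPos h₁ u s (m + 1) (j + 1)).comp (by fun_prop :
    Continuous fun q : (ℝ × ℝ) × ((Fin (m + 1) → ℝ) × (Fin (m + 1) → ℝ)) =>
      (q.1.1, q.2.1))).pow 2).add
    (((continuous_arPos h₂ u s (m + 1) (j + 1)).comp (by fun_prop :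
    Continuous fun q : (ℝ × ℝ) × ((Fin (m + 1) → ℝ) × (Fin (m + 1) → ℝ)) =>
      (q.1.2, q.2.2))).pow 2)

/-- Probability of exceeding `u` at `s` but at none of the next `m + 1` grid points. -/
theorem measure_exceed_stay [IsProbabilityMeasure μ] {X₁ X₂ : ℝ → Ω → ℝ} {h₁ h₂ : ℝ → ℝ}
    (hX₁ : IsTimeChangedBM μ X₁ h₁) (hX₂ : IsTimeChangedBM μ X₂ h₂)
    (hind : IndepFun (fun ω t => X₁ t ω) (fun ω t => X₂ t ω) μ)
    {u s : ℝ} (hu : 0 < u) (hs : 0 < s) {m : ℕ} (hM : s + (m + 1 : ℕ) / u < 1) :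
    μ {ω | u < X₁ s ω ^ 2 + X₂ s ω ^ 2 ∧ ∀ j ≤ m,
      X₁ (s + (j + 1 : ℕ) / u) ω ^ 2 + X₂ (s + (j + 1 : ℕ) / u) ω ^ 2 ≤ u} =
    ENNReal.ofReal (exp (-u / 2) / (2 * π)) *
      ((volume.restrict polarBox).prod ((stdGauss (m + 1)).prod (stdGauss (m + 1))))
        {q | (polarPt u q.1, q.2) ∈ staySet h₁ h₂ u s m} := by
  have hS : MeasurableSet {x : ℝ × ℝ | u < x.1 ^ 2 + x.2 ^ 2} :=
    measurableSet_lt (by fun_prop) (by fun_prop)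
  have hT := measurableSet_staySet h₁ h₂ u s m
  have hmp := measurePreserving_innov hX₁ hX₂ hind hu hs hM
  have hset : {ω | u < X₁ s ω ^ 2 + X₂ s ω ^ 2 ∧ ∀ j ≤ m,
      X₁ (s + (j + 1 : ℕ) / u) ω ^ 2 + X₂ (s + (j + 1 : ℕ) / u) ω ^ 2 ≤ u} =
      (fun ω => ((innov h₁ u s (m + 1 + 1) (fun t => X₁ t ω) 0,
          innov h₂ u s (m + 1 + 1) (fun t => X₂ t ω) 0),
        ((fun i : Fin (m + 1) => innov h₁ u s (m + 1 + 1) (fun t => X₁ t ω) i.succ),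
          (fun i : Fin (m + 1) => innov h₂ u s (m + 1 + 1) (fun t => X₂ t ω) i.succ)))) ⁻¹'
      (Prod.fst ⁻¹' {x : ℝ × ℝ | u < x.1 ^ 2 + x.2 ^ 2} ∩ staySet h₁ h₂ u s m) := by
    have hs1 : s + (0 : ℕ) / u ∈ Set.Ioo (0 : ℝ) 1 := grid_mem hu hs hM (Nat.zero_le _)
    rw [Nat.cast_zero, zero_div, add_zero] at hs1
    have e₁ := (sqrt_pos.2 (hX₁.pos s hs1)).ne'
    have e₂ := (sqrt_pos.2 (hX₂.pos s hs1)).ne'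
    ext ω
    simp only [Set.mem_ofPred_eq, Set.mem_preimage, Set.mem_inter_iff, staySet]
    refine and_congr ?_ (forall₂_congr fun j hj => ?_)
    · simp [innov, incr, e₁, e₂]
    · rw [hX₁.arPos_innov hu hs hM (by lia), hX₂.arPos_innov hu hs hM (by lia)]
  have hP : MeasurableSet {q : (ℝ × ℝ) × ((Fin (m + 1) → ℝ) × (Fin (m + 1) → ℝ)) |
      (polarPt u q.1, q.2) ∈ staySet h₁ h₂ u s m} := by
    have := measurable_polarPt u
    have hp : Measurable fun q : (ℝ × ℝ) × ((Fin (m + 1) → ℝ) × (Fin (m + 1) → ℝ)) =>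
      (polarPt u q.1, q.2) := by fun_prop
    exact hp hT
  rw [hset, hmp.measure_preimage ((hS.preimage measurable_fst).inter hT).nullMeasurableSet,
    Measure.prod_apply ((hS.preimage measurable_fst).inter hT), Measure.prod_apply hP]
  have hf : Measurable fun x => ((stdGauss (m + 1)).prod (stdGauss (m + 1)))
      (Prod.mk x ⁻¹' staySet h₁ h₂ u s m) := measurable_measure_prodMk_left hT
  refine Eq.trans (lintegral_congr fun x => ?_) (lintegral_gaussian_polar hu.le hf)
  by_cases hx : x ∈ {x : ℝ × ℝ | u < x.1 ^ 2 + x.2 ^ 2}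
  · rw [Set.indicator_of_mem hx]
    congr 1
    ext z
    simpa using fun _ => hx
  · rw [Set.indicator_of_notMem hx,
      ← measure_empty (μ := (stdGauss (m + 1)).prod (stdGauss (m + 1)))]
    congr 1
    ext z
    simpa using fun h => absurd h hx

lemma measurable_sq_add {X₁ X₂ : ℝ → Ω → ℝ} {h₁ h₂ : ℝ → ℝ}
    (hX₁ : IsTimeChangedBM μ X₁ h₁) (hX₂ : IsTimeChangedBM μ X₂ h₂) (s : ℝ) :
    Measurable fun ω => X₁ s ω ^ 2 + X₂ s ω ^ 2 :=
  ((hX₁.meas s).pow_const 2).add ((hX₂.meas s).pow_const 2)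

/-- Starting value and one innovation. -/
lemma exists_innovation [IsProbabilityMeasure μ] {X₁ X₂ : ℝ → Ω → ℝ} {h₁ h₂ : ℝ → ℝ}
    (hX₁ : IsTimeChangedBM μ X₁ h₁) (hX₂ : IsTimeChangedBM μ X₂ h₂)
    (hind : IndepFun (fun ω t => X₁ t ω) (fun ω t => X₂ t ω) μ)
    {s t : ℝ} (hs : 0 < s) (hst : s < t) (ht : t < 1) :
    ∃ Z₁ Z₂ : Ω → ℝ, MeasurePreserving (fun ω => ((X₁ s ω, X₂ s ω), (Z₁ ω, Z₂ ω))) μ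
        (((gaussianReal 0 1).prod (gaussianReal 0 1)).prod
          ((gaussianReal 0 1).prod (gaussianReal 0 1))) ∧
      (∀ ω, X₁ t ω = (√(h₁ s) * X₁ s ω + √(h₁ t - h₁ s) * Z₁ ω) / √(h₁ t)) ∧
      (∀ ω, X₂ t ω = (√(h₂ s) * X₂ s ω + √(h₂ t - h₂ s) * Z₂ ω) / √(h₂ t)) := by
  have hu : 0 < (t - s)⁻¹ := inv_pos.2 (sub_pos.2 hst)
  have h1u : s + ((1 : ℕ) : ℝ) / (t - s)⁻¹ = t := by simp
  have hM : s + ((1 : ℕ) : ℝ) / (t - s)⁻¹ < 1 := by rw [h1u]; exact ht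
  have e₁ := (sqrt_pos.2 (hX₁.pos s ⟨hs, hst.trans ht⟩)).ne'
  have e₂ := (sqrt_pos.2 (hX₂.pos s ⟨hs, hst.trans ht⟩)).ne'
  have hmp := measurePreserving_innov hX₁ hX₂ hind hu hs hM
  have hev : MeasurePreserving (fun z : Fin 1 → ℝ => z 0) (stdGauss 1) (gaussianReal 0 1) :=
    measurePreserving_eval (fun _ : Fin 1 => gaussianReal 0 1) 0
  have hmp2 := ((MeasurePreserving.id ((gaussianReal 0 1).prod (gaussianReal 0 1))).prod
    (hev.prod hev)).comp hmp
  refine ⟨fun ω => innov h₁ (t - s)⁻¹ s 2 (fun t => X₁ t ω) 1,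
    fun ω => innov h₂ (t - s)⁻¹ s 2 (fun t => X₂ t ω) 1, ?_, fun ω => ?_, fun ω => ?_⟩
  · convert hmp2 using 1
    ext ω <;> simp [innov, incr, e₁, e₂]
  · have := hX₁.arPos_innov hu hs hM le_rfl fun t => X₁ t ω
    rw [h1u] at this
    rw [← this, arPos, h1u]
    simp [innov, incr, e₁, partialSum]
  · have := hX₂.arPos_innov hu hs hM le_rfl fun t => X₂ t ω
    rw [h1u] at this
    rw [← this, arPos, h1u]
    simp [innov, incr, e₂, partialSum]

theorem measure_exceed [IsProbabilityMeasure μ] {X₁ X₂ : ℝ → Ω → ℝ} {h₁ h₂ : ℝ → ℝ}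
    (hX₁ : IsTimeChangedBM μ X₁ h₁) (hX₂ : IsTimeChangedBM μ X₂ h₂)
    (hind : IndepFun (fun ω t => X₁ t ω) (fun ω t => X₂ t ω) μ)
    {u s : ℝ} (hu : 0 ≤ u) (hs : s ∈ Set.Ioo (0 : ℝ) 1) :
    μ {ω | u < X₁ s ω ^ 2 + X₂ s ω ^ 2} = ENNReal.ofReal (exp (-u / 2)) := by
  obtain ⟨t, hst, ht⟩ := exists_between hs.2
  obtain ⟨Z₁, Z₂, hmp, -, -⟩ := exists_innovation hX₁ hX₂ hind hs.1 hst ht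
  have hS : MeasurableSet {x : ℝ × ℝ | u < x.1 ^ 2 + x.2 ^ 2} :=
    measurableSet_lt (by fun_prop) (by fun_prop)
  rw [← gaussian_norm_sq_tail hu]
  exact (measurePreserving_fst.comp hmp).measure_preimage hS.nullMeasurableSet

lemma add_sq_le_of_pos (a b : ℝ) {ε : ℝ} (hε : 0 < ε) :
    (a + b) ^ 2 ≤ (1 + ε) * a ^ 2 + (1 + 1 / ε) * b ^ 2 := by
  have h : 0 ≤ (ε * a - b) ^ 2 / ε := by positivity
  have : (1 + ε) * a ^ 2 + (1 + 1 / ε) * b ^ 2 - (a + b) ^ 2 = (ε * a - b) ^ 2 / ε := by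
    field_simp; ring
  linarith

lemma ar_step_sq_le {a b δ x z : ℝ} (ha : 0 < a) (hab : a < b) (hδ : 0 < δ) (hδ1 : δ ≤ 1)
    (h1 : a ≤ (1 - δ) ^ 2 * b) (h2 : b - a ≤ 4 * δ * b) :
    ((√a * x + √(b - a) * z) / √b) ^ 2 ≤ (1 + δ / 2) * (1 - δ) ^ 2 * x ^ 2 + 12 * z ^ 2 := by
  have hb : 0 < b := ha.trans hab
  rw [div_pow, sq_sqrt hb.le, div_le_iff₀ hb]
  refine (add_sq_le_of_pos _ _ (half_pos hδ)).trans ?_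
  rw [mul_pow, mul_pow, sq_sqrt ha.le, sq_sqrt (by linarith)]
  have e1 : (1 + δ / 2) * (a * x ^ 2) ≤ (1 + δ / 2) * ((1 - δ) ^ 2 * b * x ^ 2) := by gcongr
  have e2 : (1 + 1 / (δ / 2)) * ((b - a) * z ^ 2) ≤ (3 / δ) * (4 * δ * b * z ^ 2) := by
    have : 1 + 1 / (δ / 2) ≤ 3 / δ := by
      rw [show 1 + 1 / (δ / 2) = (δ + 2) / δ by field_simp]
      gcongr; linarith
    have : 0 ≤ b - a := by linarith
    gcongr
  have e3 : (3 / δ) * (4 * δ * b * z ^ 2) = 12 * z ^ 2 * b := by field_simp; ring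
  rw [e3] at e2
  linarith

/-- Two exceedances at distance `t - s` have a probability smaller than one exceedance by an
exponential factor. -/
theorem measure_exceed_two [IsProbabilityMeasure μ] {X₁ X₂ : ℝ → Ω → ℝ} {h₁ h₂ : ℝ → ℝ}
    (hX₁ : IsTimeChangedBM μ X₁ h₁) (hX₂ : IsTimeChangedBM μ X₂ h₂)
    (hind : IndepFun (fun ω t => X₁ t ω) (fun ω t => X₂ t ω) μ)
    {u s t δ : ℝ} (hu : 0 < u) (hs : 0 < s) (hst : s < t) (ht : t < 1) (hδ : 0 < δ) (hδ1 : δ ≤ 1)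
    (h11 : h₁ s ≤ (1 - δ) ^ 2 * h₁ t) (h12 : h₁ t - h₁ s ≤ 4 * δ * h₁ t)
    (h21 : h₂ s ≤ (1 - δ) ^ 2 * h₂ t) (h22 : h₂ t - h₂ s ≤ 4 * δ * h₂ t) :
    μ ({ω | u < X₁ s ω ^ 2 + X₂ s ω ^ 2} ∩ {ω | u < X₁ t ω ^ 2 + X₂ t ω ^ 2}) ≤
      ENNReal.ofReal (2 * exp (-u / 2) * exp (-(u * δ) / 48)) := by
  obtain ⟨Z₁, Z₂, hmp, hZ₁, hZ₂⟩ := exists_innovation hX₁ hX₂ hind hs hst ht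
  have hsI : s ∈ Set.Ioo (0 : ℝ) 1 := ⟨hs, hst.trans ht⟩
  have htI : t ∈ Set.Ioo (0 : ℝ) 1 := ⟨hs.trans hst, ht⟩
  have hS : ∀ v : ℝ, MeasurableSet {x : ℝ × ℝ | v < x.1 ^ 2 + x.2 ^ 2} := fun v =>
    measurableSet_lt (by fun_prop) (by fun_prop)
  have hsub : {ω | u < X₁ s ω ^ 2 + X₂ s ω ^ 2} ∩ {ω | u < X₁ t ω ^ 2 + X₂ t ω ^ 2} ⊆
      {ω | u + u * δ / 2 < X₁ s ω ^ 2 + X₂ s ω ^ 2} ∪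
      (fun ω => ((X₁ s ω, X₂ s ω), (Z₁ ω, Z₂ ω))) ⁻¹'
        ({x : ℝ × ℝ | u < x.1 ^ 2 + x.2 ^ 2} ×ˢ
          {x : ℝ × ℝ | u * δ / 24 < x.1 ^ 2 + x.2 ^ 2}) := by
    rintro ω ⟨h1, h2⟩
    simp only [Set.mem_ofPred_eq, Set.mem_union, Set.mem_preimage, Set.mem_prod] at h1 h2 ⊢
    by_contra! hc
    obtain ⟨hc1, hc2⟩ := hc
    have hc2 := hc2 h1
    rw [hZ₁, hZ₂] at h2
    have k1 := ar_step_sq_le (x := X₁ s ω) (z := Z₁ ω) (hX₁.pos s hsI)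
      (hX₁.mono hsI htI hst) hδ hδ1 h11 h12
    have k2 := ar_step_sq_le (x := X₂ s ω) (z := Z₂ ω) (hX₂.pos s hsI)
      (hX₂.mono hsI htI hst) hδ hδ1 h21 h22
    have k3 : (1 + δ / 2) * (1 - δ) ^ 2 * (X₁ s ω ^ 2 + X₂ s ω ^ 2) ≤
        (1 + δ / 2) * (1 - δ) ^ 2 * (u + u * δ / 2) := by gcongr
    have k4 : (1 + δ / 2) * (1 - δ) ^ 2 * (u + u * δ / 2) ≤ (1 - δ / 2) * u := by
      have e : (1 + δ / 2) * (1 - δ) ^ 2 * (u + u * δ / 2) =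
        (1 - δ / 2 - δ ^ 2 / 2) ^ 2 * u := by ring
      rw [e]
      have : (1 - δ / 2 - δ ^ 2 / 2) ^ 2 ≤ 1 - δ / 2 := by
        have y0 : 0 ≤ 1 - δ / 2 - δ ^ 2 / 2 := by nlinarith
        have y1 : 1 - δ / 2 - δ ^ 2 / 2 ≤ 1 - δ / 2 := by nlinarith [sq_nonneg δ]
        nlinarith
      gcongr
    linarith
  refine (measure_mono hsub).trans ((measure_union_le _ _).trans ?_)
  rw [measure_exceed hX₁ hX₂ hind (by positivity) hsI,
    hmp.measure_preimage ((hS _).prod (hS _)).nullMeasurableSet, Measure.prod_prod,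
    gaussian_norm_sq_tail hu.le, gaussian_norm_sq_tail (by positivity),
    ← ENNReal.ofReal_mul (exp_pos _).le, ← ENNReal.ofReal_add (by positivity) (by positivity)]
  refine ENNReal.ofReal_le_ofReal ?_
  have e1 : exp (-(u + u * δ / 2) / 2) ≤ exp (-u / 2) * exp (-(u * δ) / 48) := by
    rw [← exp_add]
    refine exp_le_exp.2 ?_
    nlinarith [mul_pos hu hδ]
  have e2 : exp (-u / 2) * exp (-(u * δ / 24) / 2) = exp (-u / 2) * exp (-(u * δ) / 48) := by
    congr 2; ring
  rw [e2]
  linarith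

end TimeChange

lemma tendsto_add_div {s : ℝ → ℝ} {t : ℝ} (hs : Tendsto s atTop (nhds t)) (j : ℕ) :
    Tendsto (fun u => s u + j / u) atTop (nhds t) := by
  simpa using hs.add (tendsto_const_nhds.div_atTop tendsto_id)

lemma HasStrictDerivAt.tendsto_grid_diff {h : ℝ → ℝ} {h' t : ℝ} (hh : HasStrictDerivAt h h' t)
    {s : ℝ → ℝ} (hs : Tendsto s atTop (nhds t)) (i j : ℕ) :
    Tendsto (fun u => u * (h (s u + i / u) - h (s u + j / u))) atTop
      (nhds (((i : ℝ) - j) * h')) := by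
  have hp : Tendsto (fun u => (s u + i / u, s u + j / u)) atTop (nhds (t, t)) :=
    (tendsto_add_div hs i).prodMk_nhds (tendsto_add_div hs j)
  have h1 := hh.hasStrictFDerivAt.isLittleO.comp_tendsto hp
  have h2 : (fun u : ℝ => ((i : ℝ) - j) * u⁻¹) =O[atTop] fun u : ℝ => u⁻¹ :=
    (Asymptotics.isBigO_refl (fun u : ℝ => u⁻¹) atTop).const_mul_left _
  have h3 := h1.trans_isBigO (h2.congr' (.of_forall fun u => by
    simp only [Function.comp]; ring) .rfl)
  have h4 := h3.tendsto_div_nhds_zero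
  have h5 := h4.add_const (((i : ℝ) - j) * h')
  rw [zero_add] at h5
  refine h5.congr' ?_
  filter_upwards [eventually_gt_atTop 0] with u hu
  simp only [Function.comp, ContinuousLinearMap.toSpanSingleton_apply, smul_eq_mul, div_inv_eq_mul]
  have : s u + i / u - (s u + j / u) = ((i : ℝ) - j) / u := by ring
  rw [this]
  have : ((i : ℝ) - j) / u * h' * u = ((i : ℝ) - j) * h' := by field_simp
  linear_combination -this

lemma tendsto_partialSum {M : ℕ} {f : ℝ → Fin M → ℝ} {g : Fin M → ℝ} {l : Filter ℝ}
    (hf : ∀ i, Tendsto (fun u => f u i) l (nhds (g i))) (j : ℕ) :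
    Tendsto (fun u => partialSum (f u) j) l (nhds (partialSum g j)) := by
  unfold partialSum
  refine tendsto_finsetSum _ fun i _ => ?_
  split_ifs
  · exact hf i
  · exact tendsto_const_nhds

lemma partialSum_const_mul {M : ℕ} (c : ℝ) (z : Fin M → ℝ) (j : ℕ) :
    partialSum (fun l => c * z l) j = c * partialSum z j := by
  simp [partialSum, Finset.mul_sum]

lemma partialSum_add {M : ℕ} (y z : Fin M → ℝ) (j : ℕ) :
    partialSum (fun l => y l + z l) j = partialSum y j + partialSum z j := by
  simp only [partialSum, ← Finset.sum_add_distrib]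
  refine Finset.sum_congr rfl fun l _ => ?_
  split_ifs <;> simp

/-- Expansion of the squared autoregression started at height of order `√u`. -/
theorem tendsto_arPos_sq {h : ℝ → ℝ} {h' t : ℝ} (hh : HasStrictDerivAt h h' t) (ht : 0 < h t)
    {s : ℝ → ℝ} (hs : Tendsto s atTop (nhds t))
    {M : ℕ} (a c : ℝ) (z : Fin M → ℝ) (j : ℕ) :
    Tendsto (fun u => arPos h u (s u) (√(u + a) * c) z j ^ 2 - u * c ^ 2) atTop
      (nhds (a * c ^ 2 - h' / h t * j * c ^ 2 + 2 * c * √(h' / h t) * partialSum z j)) := by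
  have hc : ContinuousAt h t := hh.hasDerivAt.continuousAt
  have lh : ∀ j : ℕ, Tendsto (fun u => h (s u + j / u)) atTop (nhds (h t)) := fun j =>
    hc.tendsto.comp (tendsto_add_div hs j)
  have lh0 : Tendsto (fun u => h (s u)) atTop (nhds (h t)) := hc.tendsto.comp hs
  have lP : Tendsto (fun u => partialSum (fun l : Fin M =>
      √(u * (h (s u + (l + 1 : ℕ) / u) - h (s u + (l : ℕ) / u))) * z l) j) atTop
      (nhds (√h' * partialSum z j)) := by
    rw [← partialSum_const_mul]
    refine tendsto_partialSum (fun l => ?_) j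
    have := (hh.tendsto_grid_diff hs (l + 1) l).sqrt
    simp only [Nat.cast_add, Nat.cast_one, add_sub_cancel_left, one_mul] at this ⊢
    exact this.mul_const _
  have lD : Tendsto (fun u => u * (h (s u) - h (s u + j / u))) atTop (nhds (-(j * h'))) := by
    have := hh.tendsto_grid_diff hs 0 j
    simpa using this
  have la : Tendsto (fun u : ℝ => √(1 + a / u)) atTop (nhds 1) := by
    have : Tendsto (fun u : ℝ => 1 + a / u) atTop (nhds (1 + 0)) :=
      tendsto_const_nhds.add (tendsto_const_nhds.div_atTop tendsto_id)
    simpa using this.sqrt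
  have lz : Tendsto (fun u : ℝ => u⁻¹) atTop (nhds 0) := tendsto_inv_atTop_zero
  have key := ((((lh0.const_mul (a * c ^ 2)).add (lD.const_mul (c ^ 2))).add
    (((lh0.sqrt.mul la).mul lP).const_mul (2 * c))).add ((lP.pow 2).mul lz)).div (lh j) ht.ne'
  have hlim : (a * c ^ 2 * h t + c ^ 2 * -(↑j * h') +
      2 * c * (√(h t) * 1 * (√h' * partialSum z j)) + (√h' * partialSum z j) ^ 2 * 0) / h t =
      a * c ^ 2 - h' / h t * j * c ^ 2 + 2 * c * √(h' / h t) * partialSum z j := by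
    have e0 : √(h' / h t) * h t = √h' * √(h t) := by
      rw [sqrt_div' _ ht.le, div_mul_eq_mul_div, div_eq_iff (sqrt_pos.2 ht).ne', mul_assoc,
        mul_self_sqrt ht.le]
    have e1 : h' / h t * h t = h' := div_mul_cancel₀ _ ht.ne'
    rw [div_eq_iff ht.ne']
    linear_combination (-2 * c * partialSum z j) * e0 + (c ^ 2 * j) * e1
  rw [hlim] at key
  refine key.congr' ?_
  filter_upwards [eventually_gt_atTop 0, eventually_gt_atTop (-a),
    (lh j).eventually_const_lt ht, lh0.eventually_const_lt ht] with u hu hua hj h0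
  have e1 : √(u + a) = √u * √(1 + a / u) := by
    rw [← sqrt_mul hu.le]; congr 1; field_simp
  have e2 : partialSum (fun l : Fin M =>
      √(u * (h (s u + (l + 1 : ℕ) / u) - h (s u + (l : ℕ) / u))) * z l) j =
      √u * partialSum (fun l : Fin M =>
      √(h (s u + (l + 1 : ℕ) / u) - h (s u + (l : ℕ) / u)) * z l) j := by
    rw [← partialSum_const_mul]
    congr 1
    ext l
    rw [sqrt_mul hu.le, mul_assoc]
  rw [Pi.div_apply]
  rw [e2]
  simp only [arPos]
  generalize partialSum (fun l : Fin M =>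
      √(h (s u + (l + 1 : ℕ) / u) - h (s u + (l : ℕ) / u)) * z l) j = Q
  rw [div_pow, sq_sqrt hj.le, e1]
  have f1 : √u ^ 2 = u := sq_sqrt hu.le
  have f2 : √(1 + a / u) ^ 2 = 1 + a / u := sq_sqrt (by
    rw [show 1 + a / u = (u + a) / u by field_simp]
    exact (div_pos (by linarith) hu).le)
  have f3 : √(h (s u)) ^ 2 = h (s u) := sq_sqrt h0.le
  rw [div_eq_iff hj.ne', sub_mul, div_mul_cancel₀ _ hj.ne']
  have f4 : a / u * u = a := by field_simp
  have f5 : u * u⁻¹ = 1 := mul_inv_cancel₀ hu.ne'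
  generalize h (s u + j / u) = y at *
  generalize h (s u) = x at *
  generalize √u = v at *
  generalize √(1 + a / u) = r at *
  generalize √x = w at *
  subst f1
  generalize a / v ^ 2 = b at *
  subst f3
  generalize (v ^ 2)⁻¹ = k at *
  have : (w * (v * r * c) + Q) ^ 2 - v ^ 2 * c ^ 2 * y =
    w ^ 2 * v ^ 2 * r ^ 2 * c ^ 2 + 2 * w * v * r * c * Q + Q ^ 2 - v ^ 2 * c ^ 2 * y := by ring
  rw [this, f2]
  linear_combination (-w ^ 2 * c ^ 2) * f4 + Q ^ 2 * f5

/-- Drift of the limiting random walk in direction `φ`. -/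
noncomputable def angleDrift (κ₁ κ₂ φ : ℝ) : ℝ := (κ₁ * cos φ ^ 2 + κ₂ * sin φ ^ 2) / 2

/-- Normalised combination of two vectors in direction `φ`. -/
noncomputable def angleMix (κ₁ κ₂ φ : ℝ) {M : ℕ} (z : (Fin M → ℝ) × (Fin M → ℝ)) : Fin M → ℝ :=
  fun l => cos φ * √κ₁ / √(2 * angleDrift κ₁ κ₂ φ) * z.1 l +
    sin φ * √κ₂ / √(2 * angleDrift κ₁ κ₂ φ) * z.2 l

lemma angleDrift_pos {κ₁ κ₂ : ℝ} (h₁ : 0 < κ₁) (h₂ : 0 < κ₂) (φ : ℝ) : 0 < angleDrift κ₁ κ₂ φ := by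
  have h := sin_sq_add_cos_sq φ
  unfold angleDrift
  rcases eq_or_ne (cos φ) 0 with hc | hc
  · rw [hc] at h ⊢
    have : sin φ ^ 2 = 1 := by linarith
    rw [this]
    positivity
  · positivity

lemma eventually_mem_staySet_iff {h₁ h₂ : ℝ → ℝ} {k₁ k₂ t κ₁ κ₂ : ℝ}
    (hh₁ : HasStrictDerivAt h₁ k₁ t) (hh₂ : HasStrictDerivAt h₂ k₂ t) (ht₁ : 0 < h₁ t)
    (ht₂ : 0 < h₂ t) (hκ₁ : κ₁ = k₁ / h₁ t) (hκ₂ : κ₂ = k₂ / h₂ t) (p₁ : 0 < κ₁) (p₂ : 0 < κ₂)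
    {s : ℝ → ℝ} (hs : Tendsto s atTop (nhds t)) (m : ℕ) {φ w : ℝ} (hw : 0 < w)
    (z : (Fin (m + 1) → ℝ) × (Fin (m + 1) → ℝ))
    (hne : ∀ j ≤ m, exp (√(2 * angleDrift κ₁ κ₂ φ) * partialSum (angleMix κ₁ κ₂ φ z) (j + 1) -
      angleDrift κ₁ κ₂ φ * (j + 1 : ℕ)) ≠ w) :
    ∀ᶠ u in atTop, (polarPt u (φ, w), z) ∈ staySet h₁ h₂ u (s u) m ↔
      tailMax (angleDrift κ₁ κ₂ φ) m (angleMix κ₁ κ₂ φ z) ≤ w := by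
  set b := angleDrift κ₁ κ₂ φ with hb
  have hbp : 0 < b := angleDrift_pos p₁ p₂ φ
  have hr : √(2 * b) ≠ 0 := (sqrt_pos.2 (by positivity)).ne'
  have hj : ∀ j ≤ m, ∀ᶠ u in atTop,
      (arPos h₁ u (s u) (polarPt u (φ, w)).1 z.1 (j + 1) ^ 2 +
        arPos h₂ u (s u) (polarPt u (φ, w)).2 z.2 (j + 1) ^ 2 ≤ u ↔
      exp (√(2 * b) * partialSum (angleMix κ₁ κ₂ φ z) (j + 1) - b * (j + 1 : ℕ)) ≤ w) := by
    intro j hjm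
    have l₁ := tendsto_arPos_sq hh₁ ht₁ hs (-2 * log w) (cos φ) z.1 (j + 1)
    have l₂ := tendsto_arPos_sq hh₂ ht₂ hs (-2 * log w) (sin φ) z.2 (j + 1)
    rw [← hκ₁] at l₁
    rw [← hκ₂] at l₂
    have hP : √(2 * b) * partialSum (angleMix κ₁ κ₂ φ z) (j + 1) =
        cos φ * √κ₁ * partialSum z.1 (j + 1) + sin φ * √κ₂ * partialSum z.2 (j + 1) := by
      unfold angleMix
      rw [partialSum_add, partialSum_const_mul, partialSum_const_mul, ← hb]
      field_simp
    have l := l₁.add l₂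
    have hsc := sin_sq_add_cos_sq φ
    have e : -2 * log w * cos φ ^ 2 - κ₁ * ((j + 1 : ℕ) : ℝ) * cos φ ^ 2 +
        2 * cos φ * √κ₁ * partialSum z.1 (j + 1) +
        (-2 * log w * sin φ ^ 2 - κ₂ * ((j + 1 : ℕ) : ℝ) * sin φ ^ 2 +
          2 * sin φ * √κ₂ * partialSum z.2 (j + 1)) =
        2 * (√(2 * b) * partialSum (angleMix κ₁ κ₂ φ z) (j + 1) - b * (j + 1 : ℕ) - log w) := by
      rw [hP, hb, angleDrift]
      linear_combination (-2 * log w) * hsc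
    rw [e] at l
    have hF : ∀ u, arPos h₁ u (s u) (√(u + -2 * log w) * cos φ) z.1 (j + 1) ^ 2 - u * cos φ ^ 2 +
        (arPos h₂ u (s u) (√(u + -2 * log w) * sin φ) z.2 (j + 1) ^ 2 - u * sin φ ^ 2) =
        arPos h₁ u (s u) (polarPt u (φ, w)).1 z.1 (j + 1) ^ 2 +
        arPos h₂ u (s u) (polarPt u (φ, w)).2 z.2 (j + 1) ^ 2 - u := by
      intro u
      have : u + -2 * log w = u - 2 * log w := by ring
      simp only [polarPt, this]
      linear_combination (-u) * hsc
    simp_rw [hF] at l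
    rcases lt_or_gt_of_ne (hne j hjm) with h | h
    · have h' := (lt_log_iff_exp_lt hw).2 h
      filter_upwards [l.eventually_lt_const (show _ < (0 : ℝ) by linarith)] with u hu
      exact iff_of_true (by linarith) h.le
    · have h' := (log_lt_iff_lt_exp hw).2 h
      filter_upwards [l.eventually_const_lt (show (0 : ℝ) < _ by linarith)] with u hu
      exact iff_of_false (by linarith) (not_le.2 h)
  have hall : ∀ᶠ u in atTop, ∀ j ∈ Set.Iic m, _ :=
    ((Set.finite_Iic m).eventually_all).2 hj
  filter_upwards [hall] with u hu
  rw [tailMax_le_iff]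
  exact forall₂_congr hu

lemma measurePreserving_rotate_gaussian {α β : ℝ} (h : α ^ 2 + β ^ 2 = 1) :
    MeasurePreserving (fun p : ℝ × ℝ => α * p.1 + β * p.2)
      ((gaussianReal 0 1).prod (gaussianReal 0 1)) (gaussianReal 0 1) := by
  refine ⟨by fun_prop, ?_⟩
  have hi : IndepFun (fun p : ℝ × ℝ => α * p.1) (fun p : ℝ × ℝ => β * p.2)
      ((gaussianReal 0 1).prod (gaussianReal 0 1)) :=
    indepFun_prod (X := fun x => α * x) (Y := fun x => β * x) (by fun_prop) (by fun_prop)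
  have m₁ : ((gaussianReal 0 1).prod (gaussianReal 0 1)).map (fun p : ℝ × ℝ => α * p.1) =
      (gaussianReal 0 1).map fun x => α * x := by
    rw [← (measurePreserving_fst (μ := gaussianReal 0 1) (ν := gaussianReal 0 1)).map_eq,
      Measure.map_map (by fun_prop) (by fun_prop)]
    simp [Function.comp_def]
  have m₂ : ((gaussianReal 0 1).prod (gaussianReal 0 1)).map (fun p : ℝ × ℝ => β * p.2) =
      (gaussianReal 0 1).map fun x => β * x := by
    rw [← (measurePreserving_snd (μ := gaussianReal 0 1) (ν := gaussianReal 0 1)).map_eq,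
      Measure.map_map (by fun_prop) (by fun_prop)]
    simp [Function.comp_def]
  have := gaussianReal_add_gaussianReal_of_indepFun hi (m₁.trans (gaussianReal_map_const_mul α))
    (m₂.trans (gaussianReal_map_const_mul β))
  refine this.trans ?_
  congr 1
  · simp
  · ext
    simpa using h

lemma measurePreserving_angleMix {κ₁ κ₂ : ℝ} (h₁ : 0 < κ₁) (h₂ : 0 < κ₂) (φ : ℝ) (M : ℕ) :
    MeasurePreserving (fun z : (Fin M → ℝ) × (Fin M → ℝ) => angleMix κ₁ κ₂ φ z)
      ((stdGauss M).prod (stdGauss M)) (stdGauss M) := by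
  have hb := angleDrift_pos h₁ h₂ φ
  have hr : (cos φ * √κ₁ / √(2 * angleDrift κ₁ κ₂ φ)) ^ 2 +
      (sin φ * √κ₂ / √(2 * angleDrift κ₁ κ₂ φ)) ^ 2 = 1 := by
    rw [div_pow, div_pow, sq_sqrt (by positivity), mul_pow, mul_pow, sq_sqrt h₁.le, sq_sqrt h₂.le,
      ← add_div, div_eq_one_iff_eq (by positivity), angleDrift]
    ring
  have e := (measurePreserving_arrowProdEquivProdArrow ℝ ℝ (Fin M)
    (fun _ => gaussianReal 0 1) (fun _ => gaussianReal 0 1)).symm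
  exact (measurePreserving_pi (fun _ : Fin M => (gaussianReal 0 1).prod (gaussianReal 0 1))
    (fun _ : Fin M => gaussianReal 0 1) fun _ => measurePreserving_rotate_gaussian hr).comp e

lemma measurable_angleMix (κ₁ κ₂ : ℝ) (M : ℕ) :
    Measurable fun y : ℝ × ((Fin M → ℝ) × (Fin M → ℝ)) => angleMix κ₁ κ₂ y.1 y.2 := by
  unfold angleMix angleDrift
  fun_prop

lemma measurable_tailMax_angleMix (κ₁ κ₂ : ℝ) (m : ℕ) :
    Measurable fun y : ℝ × ((Fin (m + 1) → ℝ) × (Fin (m + 1) → ℝ)) =>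
      tailMax (angleDrift κ₁ κ₂ y.1) m (angleMix κ₁ κ₂ y.1 y.2) := by
  refine (continuous_tailMax m).measurable.comp (Measurable.prodMk ?_ (measurable_angleMix _ _ _))
  fun_prop

/-- Moves the radial variable of `polarBox` to the last position. -/
lemma measurePreserving_radial_last {E : Type*} [MeasurableSpace E] (ρ : Measure E) [SFinite ρ] :
    MeasurePreserving (fun q : (ℝ × ℝ) × E => ((q.1.1, q.2), q.1.2))
      ((volume.restrict polarBox).prod ρ)
      (((volume.restrict (Set.Ioo (-π) π)).prod ρ).prod (volume.restrict (Set.Ioo 0 1))) := by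
  rw [polarBox, Measure.volume_eq_prod, ← Measure.prod_restrict]
  have h1 := measurePreserving_prodAssoc (volume.restrict (Set.Ioo (-π) π))
    (volume.restrict (Set.Ioo (0 : ℝ) 1)) ρ
  have h2 := (MeasurePreserving.id (volume.restrict (Set.Ioo (-π) π))).prod
    (Measure.measurePreserving_swap (μ := volume.restrict (Set.Ioo (0 : ℝ) 1)) (ν := ρ))
  have h3 := (measurePreserving_prodAssoc (volume.restrict (Set.Ioo (-π) π)) ρ
    (volume.restrict (Set.Ioo (0 : ℝ) 1))).symm
  exact h3.comp (h2.comp h1)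

lemma ae_radial_ne {E : Type*} [MeasurableSpace E] (ρ : Measure E) [SFinite ρ] {g : ℝ × E → ℝ}
    (hg : Measurable g) :
    ∀ᵐ q ∂(volume.restrict polarBox).prod ρ, g (q.1.1, q.2) ≠ q.1.2 := by
  have hmp := measurePreserving_radial_last ρ
  have hm : MeasurableSet {p : (ℝ × E) × ℝ | g p.1 = p.2} :=
    measurableSet_eq_fun (by fun_prop) (by fun_prop)
  refine hmp.quasiMeasurePreserving.ae (p := fun p => g p.1 ≠ p.2) ?_
  have : (((volume.restrict (Set.Ioo (-π) π)).prod ρ).prod (volume.restrict (Set.Ioo 0 1)))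
      {p : (ℝ × E) × ℝ | g p.1 = p.2} = 0 := by
    rw [Measure.measure_prod_null hm]
    refine .of_forall fun y => ?_
    have : Prod.mk y ⁻¹' {p : (ℝ × E) × ℝ | g p.1 = p.2} = {g y} := by
      ext w; simp [eq_comm]
    simp [this]
  simpa [ae_iff] using this

/-- The rescaled probability of staying below the level converges. -/
theorem tendsto_measure_staySet {h₁ h₂ : ℝ → ℝ} {k₁ k₂ t κ₁ κ₂ : ℝ}
    (hh₁ : HasStrictDerivAt h₁ k₁ t) (hh₂ : HasStrictDerivAt h₂ k₂ t) (ht₁ : 0 < h₁ t)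
    (ht₂ : 0 < h₂ t) (hκ₁ : κ₁ = k₁ / h₁ t) (hκ₂ : κ₂ = k₂ / h₂ t) (p₁ : 0 < κ₁) (p₂ : 0 < κ₂)
    {s : ℝ → ℝ} (hs : Tendsto s atTop (nhds t)) (m : ℕ) :
    Tendsto (fun u => ((volume.restrict polarBox).prod ((stdGauss (m + 1)).prod (stdGauss (m + 1))))
        {q | (polarPt u q.1, q.2) ∈ staySet h₁ h₂ u (s u) m}) atTop
      (nhds (∫⁻ φ in Set.Ioo (-π) π, ENNReal.ofReal (stayProb (angleDrift κ₁ κ₂ φ) m))) := by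
  have hfin : IsFiniteMeasure (volume.restrict polarBox) := by
    rw [polarBox, Measure.volume_eq_prod, ← Measure.prod_restrict]
    infer_instance
  have hmp := measurePreserving_radial_last ((stdGauss (m + 1)).prod (stdGauss (m + 1)))
  have hV : MeasurableSet {p : (ℝ × ((Fin (m + 1) → ℝ) × (Fin (m + 1) → ℝ))) × ℝ |
      tailMax (angleDrift κ₁ κ₂ p.1.1) m (angleMix κ₁ κ₂ p.1.1 p.1.2) ≤ p.2} :=
    measurableSet_le ((measurable_tailMax_angleMix κ₁ κ₂ m).comp measurable_fst) measurable_snd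
  have hlim : ((volume.restrict polarBox).prod ((stdGauss (m + 1)).prod (stdGauss (m + 1))))
      {q | tailMax (angleDrift κ₁ κ₂ q.1.1) m (angleMix κ₁ κ₂ q.1.1 q.2) ≤ q.1.2} =
      ∫⁻ φ in Set.Ioo (-π) π, ENNReal.ofReal (stayProb (angleDrift κ₁ κ₂ φ) m) := by
    refine (hmp.measure_preimage hV.nullMeasurableSet).trans ?_
    rw [Measure.prod_apply hV]
    have hin : ∀ y : ℝ × ((Fin (m + 1) → ℝ) × (Fin (m + 1) → ℝ)),
        (volume.restrict (Set.Ioo (0 : ℝ) 1)) (Prod.mk y ⁻¹' {p |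
          tailMax (angleDrift κ₁ κ₂ p.1.1) m (angleMix κ₁ κ₂ p.1.1 p.1.2) ≤ p.2}) =
        ENNReal.ofReal (max 0 (1 - tailMax (angleDrift κ₁ κ₂ y.1) m (angleMix κ₁ κ₂ y.1 y.2))) := by
      intro y
      set T := tailMax (angleDrift κ₁ κ₂ y.1) m (angleMix κ₁ κ₂ y.1 y.2)
      have hT : 0 < T := tailMax_pos _ _ _
      have : Prod.mk y ⁻¹' {p : (ℝ × ((Fin (m + 1) → ℝ) × (Fin (m + 1) → ℝ))) × ℝ |
          tailMax (angleDrift κ₁ κ₂ p.1.1) m (angleMix κ₁ κ₂ p.1.1 p.1.2) ≤ p.2} = Set.Ici T := rfl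
      rw [this, Measure.restrict_apply measurableSet_Ici]
      have : Set.Ici T ∩ Set.Ioo 0 1 = Set.Ico T 1 := by
        ext w
        simp only [Set.mem_inter_iff, Set.mem_Ici, Set.mem_Ioo, Set.mem_Ico]
        constructor <;> intro h <;> grind
      rw [this, Real.volume_Ico, ENNReal.ofReal_max, ENNReal.ofReal_zero, max_eq_right zero_le]
    simp_rw [hin]
    have hmeas : Measurable fun y : ℝ × ((Fin (m + 1) → ℝ) × (Fin (m + 1) → ℝ)) =>
        ENNReal.ofReal (max 0 (1 - tailMax (angleDrift κ₁ κ₂ y.1) m (angleMix κ₁ κ₂ y.1 y.2))) :=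
      (measurable_const.max ((measurable_tailMax_angleMix κ₁ κ₂ m).const_sub 1)).ennreal_ofReal
    rw [lintegral_prod _ hmeas.aemeasurable]
    refine lintegral_congr fun φ => ?_
    have hmix := measurePreserving_angleMix p₁ p₂ φ (m + 1)
    have hT : Measurable fun z => tailMax (angleDrift κ₁ κ₂ φ) m z :=
      (continuous_tailMax m).measurable.comp measurable_prodMk_left
    have hT' : Measurable fun z => max 0 (1 - tailMax (angleDrift κ₁ κ₂ φ) m z) :=
      measurable_const.max (hT.const_sub 1)
    rw [hmix.lintegral_comp (f := fun z => ENNReal.ofReal (max 0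
      (1 - tailMax (angleDrift κ₁ κ₂ φ) m z))) hT'.ennreal_ofReal, stayProb,
      ofReal_integral_eq_lintegral_ofReal]
    · refine Integrable.of_bound hT'.aestronglyMeasurable 1 (.of_forall fun z => ?_)
      rw [norm_of_nonneg (le_max_left _ _)]
      exact max_le zero_le_one (by linarith [tailMax_pos (angleDrift κ₁ κ₂ φ) m z])
    · exact .of_forall fun z => le_max_left _ _
  rw [← hlim]
  refine tendsto_measure_of_ae_tendsto_indicator_of_isFiniteMeasure atTop ?_ (fun u => ?_) ?_
  · exact hmp.measurable hV
  · have := measurable_polarPt u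
    have hp : Measurable fun q : (ℝ × ℝ) × ((Fin (m + 1) → ℝ) × (Fin (m + 1) → ℝ)) =>
      (polarPt u q.1, q.2) := by fun_prop
    exact hp (measurableSet_staySet h₁ h₂ u (s u) m)
  · have hpos : ∀ᵐ q ∂(volume.restrict polarBox).prod
        ((stdGauss (m + 1)).prod (stdGauss (m + 1))), 0 < q.1.2 := by
      have : ∀ᵐ p ∂volume.restrict polarBox, 0 < p.2 := by
        filter_upwards [ae_restrict_mem (measurableSet_Ioo.prod measurableSet_Ioo)] with p hp
        exact hp.2.1
      exact measurePreserving_fst.quasiMeasurePreserving.ae this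
    have hne : ∀ᵐ q ∂(volume.restrict polarBox).prod
        ((stdGauss (m + 1)).prod (stdGauss (m + 1))), ∀ j : ℕ,
        exp (√(2 * angleDrift κ₁ κ₂ q.1.1) * partialSum (angleMix κ₁ κ₂ q.1.1 q.2) (j + 1) -
          angleDrift κ₁ κ₂ q.1.1 * (j + 1 : ℕ)) ≠ q.1.2 := by
      refine ae_all_iff.2 fun j => ?_
      refine ae_radial_ne _ (g := fun y => exp (√(2 * angleDrift κ₁ κ₂ y.1) *
        partialSum (angleMix κ₁ κ₂ y.1 y.2) (j + 1) - angleDrift κ₁ κ₂ y.1 * (j + 1 : ℕ))) ?_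
      have e1 := measurable_angleMix κ₁ κ₂ (m + 1)
      have e2 : Measurable fun y : ℝ × ((Fin (m + 1) → ℝ) × (Fin (m + 1) → ℝ)) =>
          partialSum (angleMix κ₁ κ₂ y.1 y.2) (j + 1) := by
        unfold partialSum
        refine Finset.measurable_fun_sum _ fun l _ => ?_
        split_ifs <;> fun_prop
      have e3 : Measurable (angleDrift κ₁ κ₂) := by unfold angleDrift; fun_prop
      fun_prop
    filter_upwards [hpos, hne] with q h0 hq
    exact eventually_mem_staySet_iff hh₁ hh₂ ht₁ ht₂ hκ₁ hκ₂ p₁ p₂ hs m h0 q.2 fun j _ => hq j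

/-- The odds `t / (1 - t)`. -/
noncomputable def odds (t : ℝ) : ℝ := t / (1 - t)

lemma odds_pos {t : ℝ} (ht : t ∈ Set.Ioo (0 : ℝ) 1) : 0 < odds t :=
  div_pos ht.1 (sub_pos.2 ht.2)

lemma strictMonoOn_odds : StrictMonoOn odds (Set.Ioo 0 1) := by
  intro s hs t ht hst
  have := sub_pos.2 hs.2
  have := sub_pos.2 ht.2
  unfold odds
  rw [div_lt_div_iff₀ ‹_› ‹_›]
  nlinarith

lemma hasStrictDerivAt_odds {t : ℝ} (ht : t ∈ Set.Ioo (0 : ℝ) 1) :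
    HasStrictDerivAt odds (1 / (1 - t) ^ 2) t := by
  have h0 := (sub_pos.2 ht.2).ne'
  have := (hasStrictDerivAt_id t).div ((hasStrictDerivAt_id t).const_sub 1) h0
  refine this.congr_deriv ?_
  simp

lemma hasStrictDerivAt_odds_sq {t : ℝ} (ht : t ∈ Set.Ioo (0 : ℝ) 1) :
    HasStrictDerivAt (fun t => odds t ^ 2) (2 * odds t * (1 / (1 - t) ^ 2)) t := by
  refine ((hasStrictDerivAt_odds ht).pow 2).congr_deriv ?_
  simp

section Events

variable {Ω : Type*}

/-- The exceedance event at the `k`-th point of the grid of mesh `1 / u`. -/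
def exceed (X₁ X₂ : ℝ → Ω → ℝ) (u : ℝ) (k : ℕ) : Set Ω :=
  {ω | u < X₁ (k / u) ω ^ 2 + X₂ (k / u) ω ^ 2}

/-- The `k`-th event happens and none of the next `w` ones does. -/
def lastIn (E : ℕ → Set Ω) (w k : ℕ) : Set Ω := E k \ ⋃ j ∈ Finset.range w, E (k + (j + 1))

lemma lastIn_subset (E : ℕ → Set Ω) (w k : ℕ) : lastIn E w k ⊆ E k := Set.sdiff_subset

lemma lastIn_exceed_eq (X₁ X₂ : ℝ → Ω → ℝ) (u : ℝ) (m k : ℕ) : lastIn (exceed X₁ X₂ u) (m + 1) k =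
    {ω | u < X₁ (k / u) ω ^ 2 + X₂ (k / u) ω ^ 2 ∧ ∀ j ≤ m,
      X₁ (k / u + (j + 1 : ℕ) / u) ω ^ 2 + X₂ (k / u + (j + 1 : ℕ) / u) ω ^ 2 ≤ u} := by
  ext ω
  simp only [lastIn, exceed, Set.mem_sdiff, Set.mem_ofPred_eq, Set.mem_iUnion,
    Finset.mem_range, not_exists, not_lt, Nat.cast_add, add_div, Nat.lt_succ_iff]

end Events

section ScanPairs

variable {Ω : Type*} [MeasurableSpace Ω] {μ : Measure Ω}

lemma isTimeChangedBM_odds_sq {X : ℝ → Ω → ℝ} (hX : CenteredGaussian μ X)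
    (hm : ∀ t, Measurable (X t))
    (hcov : ∀ s t : ℝ, s ∈ Set.Ioo (0:ℝ) 1 → t ∈ Set.Ioo (0:ℝ) 1 → ∫ ω, X s ω * X t ω ∂μ =
      (min s t * (1 - max s t)) / (max s t * (1 - min s t))) :
    IsTimeChangedBM μ X fun t => odds t ^ 2 where
  gauss := hX
  meas := hm
  pos t ht := pow_pos (odds_pos ht) 2
  mono s hs t ht hst := pow_lt_pow_left₀ (strictMonoOn_odds hs ht hst) (odds_pos hs).le two_ne_zero
  cov s hs t ht hst := by
    rw [hcov s t hs ht, min_eq_left hst, max_eq_right hst, sqrt_sq (odds_pos hs).le,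
      sqrt_sq (odds_pos ht).le, odds, odds]
    have := hs.1.ne'
    have := ht.1.ne'
    have := (sub_pos.2 hs.2).ne'
    have := (sub_pos.2 ht.2).ne'
    field_simp

lemma isTimeChangedBM_odds {X : ℝ → Ω → ℝ} (hX : CenteredGaussian μ X)
    (hm : ∀ t, Measurable (X t))
    (hcov : ∀ s t : ℝ, s ∈ Set.Ioo (0:ℝ) 1 → t ∈ Set.Ioo (0:ℝ) 1 → ∫ ω, X s ω * X t ω ∂μ =
      (min s t * (1 - max s t)) /
        √(min s t * (1 - min s t) * (max s t) * (1 - max s t))) :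
    IsTimeChangedBM μ X odds where
  gauss := hX
  meas := hm
  pos t ht := odds_pos ht
  mono := strictMonoOn_odds
  cov s hs t ht hst := by
    rw [hcov s t hs ht, min_eq_left hst, max_eq_right hst, ← sqrt_mul (odds_pos hs).le, odds, odds]
    have s0 := hs.1
    have t0 := ht.1
    have s1 := sub_pos.2 hs.2
    have t1 := sub_pos.2 ht.2
    have e : s / (1 - s) * (t / (1 - t)) =
        (s * (1 - s) * t * (1 - t)) / ((1 - s) * (1 - t)) ^ 2 := by field_simp
    have hp : 0 < √(s * (1 - s) * t * (1 - t)) := sqrt_pos.2 (by positivity)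
    rw [e, sqrt_div (by positivity), sqrt_sq (by positivity)]
    field_simp

/-- The independent pair of processes behind the scan statistic. -/
structure IsScanPair (μ : Measure Ω) (X₁ X₂ : ℝ → Ω → ℝ) : Prop where
  fst : IsTimeChangedBM μ X₁ fun t => odds t ^ 2
  snd : IsTimeChangedBM μ X₂ odds
  indep : IndepFun (fun ω t => X₁ t ω) (fun ω t => X₂ t ω) μ

namespace IsScanPair

variable {X₁ X₂ : ℝ → Ω → ℝ}

lemma measurableSet_exceed (hX : IsScanPair μ X₁ X₂) (u : ℝ) (k : ℕ) :
    MeasurableSet (exceed X₁ X₂ u k) :=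
  measurableSet_lt measurable_const (measurable_sq_add hX.fst hX.snd _)

variable [IsProbabilityMeasure μ]

lemma measureReal_exceed (hX : IsScanPair μ X₁ X₂) {u : ℝ} {k : ℕ} (hk : 0 < k) (hu : k < u) :
    μ.real (exceed X₁ X₂ u k) = exp (-u / 2) := by
  have hu0 : 0 < u := (Nat.cast_nonneg k).trans_lt hu
  have hk' : (0 : ℝ) < k := by exact_mod_cast hk
  have := measure_exceed hX.fst hX.snd hX.indep hu0.le
    (s := k / u) ⟨by positivity, (div_lt_one hu0).2 hu⟩
  rw [measureReal_def, exceed, this, ENNReal.toReal_ofReal (exp_pos _).le]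

lemma measureReal_exceed_inter (hX : IsScanPair μ X₁ X₂) {u : ℝ} {k l : ℕ} (hk : 0 < k)
    (hkl : k < l) (hu : l < u) :
    μ.real (exceed X₁ X₂ u k ∩ exceed X₁ X₂ u l) ≤
      exp (-u / 2) * (2 * exp (-((l : ℝ) - k) / 96)) := by
  have hu0 : 0 < u := (Nat.cast_nonneg l).trans_lt hu
  have hk' : (0 : ℝ) < k := by exact_mod_cast hk
  have hkl' : (k : ℝ) < l := by exact_mod_cast hkl
  set s := (k : ℝ) / u with hs
  set t := (l : ℝ) / u with ht
  have hst : s < t := div_lt_div_of_pos_right hkl' hu0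
  have s0 : 0 < s := by positivity
  have t1 : t < 1 := (div_lt_one hu0).2 hu
  have hsI : s ∈ Set.Ioo (0 : ℝ) 1 := ⟨s0, hst.trans t1⟩
  have htI : t ∈ Set.Ioo (0 : ℝ) 1 := ⟨s0.trans hst, t1⟩
  have ps := odds_pos hsI
  have pt := odds_pos htI
  set r := odds s / odds t with hr
  have r0 : 0 < r := by positivity
  have hrs : odds s = r * odds t := by rw [hr]; field_simp
  have hrt : t - s ≤ 1 - r := by
    have e : 1 - r = (t - s) / (t * (1 - s)) := by
      rw [hr, odds, odds]
      have := (sub_pos.2 hsI.2).ne'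
      have := (sub_pos.2 htI.2).ne'
      have := s0.ne'
      have := htI.1.ne'
      field_simp
      ring
    have hp : 0 < t * (1 - s) := mul_pos htI.1 (sub_pos.2 hsI.2)
    rw [e, le_div_iff₀ hp]
    have : t * (1 - s) ≤ 1 := by nlinarith [hsI.1, htI.1]
    nlinarith
  set y := √r with hy
  have y0 : 0 ≤ y := sqrt_nonneg r
  have yr : y ^ 2 = r := sq_sqrt r0.le
  have y1 : y < 1 := by nlinarith
  have hd : (t - s) / 2 ≤ 1 - y := by nlinarith
  have hmain := measure_exceed_two hX.fst hX.snd hX.indep (δ := 1 - y) hu0 s0 hst t1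
    (by linarith) (by linarith)
    (by
      rw [hrs, sub_sub_cancel, yr, mul_pow]
      have : r ^ 2 ≤ r := by nlinarith
      gcongr)
    (by
      rw [hrs]
      have : (odds t ^ 2 - (r * odds t) ^ 2) = (1 - r ^ 2) * odds t ^ 2 := by ring
      rw [this]
      have : 1 - r ^ 2 ≤ 4 * (1 - y) := by
        rw [← yr]
        have : (1 - y) * ((1 + y) * (1 + y ^ 2)) ≤ (1 - y) * 4 := by
          have : 0 ≤ 1 - y := by linarith
          gcongr
          nlinarith
        linarith
      gcongr)
    (by rw [hrs, sub_sub_cancel, yr])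
    (by
      rw [hrs]
      have : odds t - r * odds t = (1 - r) * odds t := by ring
      rw [this]
      have : 1 - r ≤ 4 * (1 - y) := by nlinarith
      gcongr)
  have h1 := ENNReal.toReal_mono ENNReal.ofReal_ne_top hmain
  rw [ENNReal.toReal_ofReal (by positivity)] at h1
  refine (h1 : μ.real (exceed X₁ X₂ u k ∩ exceed X₁ X₂ u l) ≤ _).trans ?_
  have : exp (-(u * (1 - y)) / 48) ≤ exp (-((l : ℝ) - k) / 96) := by
    refine exp_le_exp.2 ?_
    have e : (l : ℝ) - k = u * (t - s) := by rw [hs, ht]; field_simp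
    rw [e]
    nlinarith
  nlinarith [exp_pos (-u / 2)]

/-- Local limit of the rescaled probability that an exceedance is the last one in a block. -/
theorem tendsto_lastIn_exceed (hX : IsScanPair μ X₁ X₂) {t : ℝ}
    (ht : t ∈ Set.Ioo (0 : ℝ) 1) (m : ℕ) :
    Tendsto (fun u => exp (u / 2) * μ.real (lastIn (exceed X₁ X₂ u) (m + 1) ⌈u * t⌉₊)) atTop
      (nhds ((2 * π)⁻¹ * ∫ φ in (-π)..π,
        stayProb ((cos φ ^ 2 + 1 / 2 * sin φ ^ 2) / (t * (1 - t))) m)) := by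
  have hs : Tendsto (fun u : ℝ => (⌈u * t⌉₊ : ℝ) / u) atTop (nhds t) := by
    have := tendsto_nat_ceil_mul_div_atTop ht.1.le (R := ℝ)
    simpa [mul_comm] using this
  have t0 := ht.1
  have t1 := sub_pos.2 ht.2
  have po := odds_pos ht
  have hp : 0 < t * (1 - t) := by positivity
  have key := tendsto_measure_staySet (κ₁ := 2 / (t * (1 - t))) (κ₂ := 1 / (t * (1 - t)))
    (hasStrictDerivAt_odds_sq ht) (hasStrictDerivAt_odds ht) (pow_pos po 2) po
    (by rw [odds]; field_simp) (by rw [odds]; field_simp) (by positivity) (by positivity) hs m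
  have hd : ∀ φ, angleDrift (2 / (t * (1 - t))) (1 / (t * (1 - t))) φ =
      (cos φ ^ 2 + 1 / 2 * sin φ ^ 2) / (t * (1 - t)) := by
    intro φ
    rw [angleDrift]
    field_simp
  simp_rw [hd] at key
  have hmeas : Measurable fun φ => stayProb ((cos φ ^ 2 + 1 / 2 * sin φ ^ 2) / (t * (1 - t))) m :=
    (measurable_stayProb m).comp (by fun_prop)
  have hint : ∫⁻ φ in Set.Ioo (-π) π, ENNReal.ofReal
      (stayProb ((cos φ ^ 2 + 1 / 2 * sin φ ^ 2) / (t * (1 - t))) m) =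
      ENNReal.ofReal (∫ φ in (-π)..π,
        stayProb ((cos φ ^ 2 + 1 / 2 * sin φ ^ 2) / (t * (1 - t))) m) := by
    rw [intervalIntegral.integral_of_le (by linarith [pi_pos]),
      ← restrict_Ioo_eq_restrict_Ioc, ofReal_integral_eq_lintegral_ofReal]
    · refine Integrable.of_bound hmeas.aestronglyMeasurable 1 (.of_forall fun φ => ?_)
      rw [norm_of_nonneg (stayProb_nonneg _ _)]
      exact stayProb_le_one _ _
    · exact .of_forall fun φ => stayProb_nonneg _ _
  rw [hint] at key
  have key2 := (ENNReal.tendsto_toReal ENNReal.ofReal_ne_top).comp key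
  rw [ENNReal.toReal_ofReal (intervalIntegral.integral_nonneg (by linarith [pi_pos])
    fun φ _ => stayProb_nonneg _ _)] at key2
  refine (key2.const_mul (2 * π)⁻¹).congr' ?_
  filter_upwards [eventually_gt_atTop 0,
    (tendsto_add_div hs (m + 1)).eventually_lt_const ht.2] with u hu0 hu1
  have hc : 0 < ⌈u * t⌉₊ := Nat.ceil_pos.2 (by positivity)
  have hc' : (0 : ℝ) < ⌈u * t⌉₊ := by exact_mod_cast hc
  rw [lastIn_exceed_eq, measureReal_def, measure_exceed_stay hX.fst hX.snd hX.indep hu0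
    (by positivity) hu1, ENNReal.toReal_mul, ENNReal.toReal_ofReal (by positivity), ← mul_assoc]
  simp only [Function.comp]
  congr 1
  rw [mul_div_assoc', ← exp_add]
  simp [neg_div]

end IsScanPair

end ScanPairs

section Union

variable {Ω : Type*} [MeasurableSpace Ω] {μ : Measure Ω} [IsProbabilityMeasure μ]

lemma measurableSet_lastIn {E : ℕ → Set Ω} (hE : ∀ k, MeasurableSet (E k)) (w k : ℕ) :
    MeasurableSet (lastIn E w k) :=
  (hE k).diff (Finset.measurableSet_biUnion _ fun _ _ => hE _)

lemma measureReal_biUnion_le_lastIn (E : ℕ → Set Ω) (w a b : ℕ) :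
    μ.real (⋃ k ∈ Finset.Ico a b, E k) ≤
      ∑ k ∈ Finset.Ico a b, μ.real (lastIn E w k) + ∑ k ∈ Finset.Ico b (b + w), μ.real (E k) := by
  have hsub : (⋃ k ∈ Finset.Ico a b, E k) ⊆
      (⋃ k ∈ Finset.Ico a b, lastIn E w k) ∪ ⋃ k ∈ Finset.Ico b (b + w), E k := by
    intro ω hω
    simp only [Set.mem_iUnion, exists_prop] at hω
    classical
    obtain ⟨k, hk, hmax⟩ := ((Finset.Ico a b).filter fun k => ω ∈ E k).exists_max_image id
      (by obtain ⟨k, hk⟩ := hω; exact ⟨k, Finset.mem_filter.2 hk⟩)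
    obtain ⟨hk, hkE⟩ := Finset.mem_filter.1 hk
    by_cases h : ω ∈ lastIn E w k
    · exact .inl (Set.mem_biUnion hk h)
    · right
      simp only [lastIn, Set.mem_sdiff, hkE, true_and, not_not, Set.mem_iUnion,
        Finset.mem_range, exists_prop] at h
      obtain ⟨j, hj, hjE⟩ := h
      rw [Finset.mem_Ico] at hk
      refine Set.mem_biUnion (Finset.mem_coe.2 (Finset.mem_Ico.2 ⟨?_, by lia⟩)) hjE
      by_contra! hlt
      have := hmax (k + (j + 1)) (Finset.mem_filter.2 ⟨Finset.mem_Ico.2 ⟨by lia, hlt⟩, hjE⟩)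
      simp only [id] at this
      lia
  refine (measureReal_mono hsub (measure_ne_top _ _)).trans ((measureReal_union_le _ _).trans ?_)
  exact add_le_add (measureReal_biUnion_finset_le _ _) (measureReal_biUnion_finset_le _ _)

lemma sum_lastIn_sub_le_measureReal_biUnion {E : ℕ → Set Ω} (hE : ∀ k, MeasurableSet (E k))
    (w a b : ℕ) :
    ∑ k ∈ Finset.Ico a b, (μ.real (lastIn E w k) -
      ∑ l ∈ Finset.Ico (k + w + 1) b, μ.real (E k ∩ E l)) ≤
      μ.real (⋃ k ∈ Finset.Ico a b, E k) := by
  have hD : ∀ k, MeasurableSet (lastIn E w k \ ⋃ l ∈ Finset.Ico (k + w + 1) b, E l) := fun k =>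
    (measurableSet_lastIn hE w k).diff (Finset.measurableSet_biUnion _ fun _ _ => hE _)
  have h1 : ∑ k ∈ Finset.Ico a b,
      μ.real (lastIn E w k \ ⋃ l ∈ Finset.Ico (k + w + 1) b, E l) ≤
      μ.real (⋃ k ∈ Finset.Ico a b, E k) := by
    rw [← measureReal_biUnion_finset ?_ fun k _ => hD k]
    · exact measureReal_mono (Set.iUnion₂_mono fun k _ =>
        Set.sdiff_subset.trans (lastIn_subset E w k)) (measure_ne_top _ _)
    · have key : ∀ i j : ℕ, i < j → j < b → ∀ ω,
          ω ∈ lastIn E w i \ ⋃ l ∈ Finset.Ico (i + w + 1) b, E l → ω ∈ E j → False := by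
        intro i j hij hjb ω h1 h2
        simp only [lastIn, Set.mem_sdiff, Set.mem_iUnion, Finset.mem_range, Finset.mem_Ico,
          exists_prop, not_exists, not_and] at h1
        by_cases hw : j < i + w + 1
        · refine h1.1.2 (j - i - 1) (by lia) ?_
          rwa [show i + (j - i - 1 + 1) = j by lia]
        · exact h1.2 j ⟨by lia, hjb⟩ h2
      intro i hi j hj hij
      rw [Finset.coe_Ico, Set.mem_Ico] at hi hj
      refine Set.disjoint_left.2 fun ω h1 h2 => ?_
      rcases lt_or_gt_of_ne hij with h | h
      · exact key i j h hj.2 ω h1 (lastIn_subset E w j h2.1)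
      · exact key j i h hi.2 ω h2 (lastIn_subset E w i h1.1)
  refine (Finset.sum_le_sum fun k _ => ?_).trans h1
  rw [sub_le_iff_le_add]
  have hsub : lastIn E w k ⊆ (lastIn E w k \ ⋃ l ∈ Finset.Ico (k + w + 1) b, E l) ∪
      ⋃ l ∈ Finset.Ico (k + w + 1) b, (E k ∩ E l) := by
    intro ω h
    by_cases h' : ω ∈ ⋃ l ∈ Finset.Ico (k + w + 1) b, E l
    · right
      simp only [Set.mem_iUnion, exists_prop] at h' ⊢
      obtain ⟨l, hl, hlE⟩ := h'
      exact ⟨l, hl, lastIn_subset E w k h, hlE⟩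
    · exact .inl ⟨h, h'⟩
  refine (measureReal_mono hsub (measure_ne_top _ _)).trans ((measureReal_union_le _ _).trans ?_)
  gcongr
  exact measureReal_biUnion_finset_le _ _

lemma sum_pow_sub_le {r : ℝ} (h0 : 0 ≤ r) (h1 : r < 1) (k w b : ℕ) :
    ∑ l ∈ Finset.Ico (k + w + 1) b, r ^ (l - k) ≤ r ^ (w + 1) / (1 - r) := by
  have h2 : ∑ l ∈ Finset.Ico (k + w + 1) b, r ^ (l - k) =
      ∑ i ∈ Finset.range (b - (k + w + 1)), r ^ (w + 1) * r ^ i := by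
    rw [Finset.sum_Ico_eq_sum_range]
    refine Finset.sum_congr rfl fun i _ => ?_
    rw [← pow_add]
    congr 1
    lia
  rw [h2, ← Finset.mul_sum, div_eq_mul_inv]
  gcongr
  rw [← tsum_geometric_of_lt_one h0 h1]
  exact (summable_geometric_of_lt_one h0 h1).sum_le_tsum _ fun i _ => pow_nonneg h0 i

lemma sum_lastIn_le_of_inter_le {E : ℕ → Set Ω} (hE : ∀ k, MeasurableSet (E k)) {r c : ℝ}
    (h0 : 0 ≤ r) (h1 : r < 1) (hc : 0 ≤ c) (w a b : ℕ)
    (hr : ∀ k l, a ≤ k → k < l → l < b → μ.real (E k ∩ E l) ≤ c * r ^ (l - k)) :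
    ∑ k ∈ Finset.Ico a b, μ.real (lastIn E w k) ≤
      μ.real (⋃ k ∈ Finset.Ico a b, E k) + (b - a : ℕ) * (c * (r ^ (w + 1) / (1 - r))) := by
  have h := sum_lastIn_sub_le_measureReal_biUnion (μ := μ) hE w a b
  rw [Finset.sum_sub_distrib] at h
  have h2 : ∑ k ∈ Finset.Ico a b, ∑ l ∈ Finset.Ico (k + w + 1) b, μ.real (E k ∩ E l) ≤
      ∑ k ∈ Finset.Ico a b, c * (r ^ (w + 1) / (1 - r)) := by
    refine Finset.sum_le_sum fun k hk => ?_
    refine (Finset.sum_le_sum fun l hl => hr k l (Finset.mem_Ico.1 hk).1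
      (by have := (Finset.mem_Ico.1 hl).1; lia) (Finset.mem_Ico.1 hl).2).trans ?_
    rw [← Finset.mul_sum]
    exact mul_le_mul_of_nonneg_left (sum_pow_sub_le h0 h1 k w b) hc
  rw [Finset.sum_const, Nat.card_Ico, nsmul_eq_mul] at h2
  linarith

end Union

/-- Riemann sums of a sequence of step functions converge to the integral of the limit. -/
theorem tendsto_sum_grid {f : ℝ → ℕ → ℝ} {g : ℝ → ℝ} {T₁ T₂ : ℝ} (h1 : 0 < T₁) (h12 : T₁ < T₂)
    (h2 : T₂ < 1) (hbd : ∀ (u : ℝ) (k : ℕ), 0 < k → (k : ℝ) < u → |f u k| ≤ 1)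
    (hlim : ∀ t ∈ Set.Ioo (0 : ℝ) 1, Tendsto (fun u => f u ⌈u * t⌉₊) atTop (nhds (g t))) :
    Tendsto (fun u => u⁻¹ * ∑ k ∈ Finset.Ico ⌈u * T₁⌉₊ (⌊u * T₂⌋₊ + 1), f u k) atTop
      (nhds (∫ t in T₁..T₂, g t)) := by
  set S : ℝ → Finset ℕ := fun u => Finset.Ico ⌈u * T₁⌉₊ (⌊u * T₂⌋₊ + 1) with hS
  have hpos : ∀ u : ℝ, 0 < u → ∀ k ∈ S u, 0 < k ∧ (k : ℝ) < u := by
    intro u hu k hk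
    rw [hS, Finset.mem_Ico, Nat.lt_succ_iff] at hk
    refine ⟨(Nat.ceil_pos.2 (by positivity)).trans_le hk.1, ?_⟩
    have := (Nat.le_floor_iff (by nlinarith)).1 hk.2
    nlinarith
  have hcell : ∀ u : ℝ, 0 < u → ∀ k : ℕ, 0 < k → ∀ t,
      t ∈ Set.Ioc (((k - 1 : ℕ) : ℝ) / u) (k / u) ↔ ⌈u * t⌉₊ = k := by
    intro u hu k hk t
    rw [Nat.ceil_eq_iff hk.ne', Set.mem_Ioc, div_lt_iff₀ hu, le_div_iff₀ hu, mul_comm]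
  have hF : ∀ u : ℝ, 0 < u → (fun t => if ⌈u * t⌉₊ ∈ S u then f u ⌈u * t⌉₊ else 0) =
      fun t => ∑ k ∈ S u,
        (Set.Ioc (((k - 1 : ℕ) : ℝ) / u) (k / u)).indicator (fun _ => f u k) t := by
    intro u hu
    ext t
    rw [← Finset.sum_ite_eq]
    refine Finset.sum_congr rfl fun k hk => ?_
    simp only [Set.indicator_apply, hcell u hu k (hpos u hu k hk).1 t]
  have hint : ∀ u : ℝ, 0 < u → ∀ k, IntegrableOn (fun _ : ℝ => f u k)
      (Set.Ioc (((k - 1 : ℕ) : ℝ) / u) (k / u)) := fun u hu k => integrableOn_const (by simp)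
  have hsum : ∀ u : ℝ, 0 < u → ∫ t, (if ⌈u * t⌉₊ ∈ S u then f u ⌈u * t⌉₊ else 0) =
      u⁻¹ * ∑ k ∈ S u, f u k := by
    intro u hu
    rw [hF u hu, integral_finsetSum _ fun k _ =>
        (hint u hu k).integrable_indicator measurableSet_Ioc,
      Finset.mul_sum]
    refine Finset.sum_congr rfl fun k hk => ?_
    rw [integral_indicator measurableSet_Ioc, setIntegral_const, measureReal_def, Real.volume_Ioc,
      smul_eq_mul, Nat.cast_sub (hpos u hu k hk).1, ← sub_div, Nat.cast_one, sub_sub_cancel,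
      ENNReal.toReal_ofReal (by positivity), one_div]
  have key : Tendsto (fun u => ∫ t, (if ⌈u * t⌉₊ ∈ S u then f u ⌈u * t⌉₊ else 0)) atTop
      (nhds (∫ t, (Set.Ioc T₁ T₂).indicator g t)) := by
    refine tendsto_integral_filter_of_dominated_convergence
      ((Set.Ioc (0 : ℝ) 1).indicator fun _ => 1) ?_ ?_ ?_ ?_
    · filter_upwards [eventually_gt_atTop 0] with u hu
      rw [hF u hu]
      exact (integrable_finsetSum _ fun k _ =>
        (hint u hu k).integrable_indicator measurableSet_Ioc).aestronglyMeasurable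
    · filter_upwards [eventually_gt_atTop 0] with u hu
      refine .of_forall fun t => ?_
      split_ifs with h
      · obtain ⟨k0, k1⟩ := hpos u hu _ h
        have h0 : 0 < u * t := Nat.ceil_pos.1 k0
        have h3 : t ∈ Set.Ioc (0 : ℝ) 1 := by
          refine ⟨pos_of_mul_pos_right h0 hu.le, ?_⟩
          have := Nat.le_ceil (u * t)
          nlinarith
        rw [Set.indicator_of_mem h3]
        exact hbd u _ k0 k1
      · rw [norm_zero]
        exact Set.indicator_nonneg (fun _ _ => zero_le_one) _
    · exact (integrableOn_const (by simp)).integrable_indicator measurableSet_Ioc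
    · have hne : ∀ c : ℝ, ∀ᵐ t : ℝ, t ≠ c := fun c => by simp [ae_iff]
      filter_upwards [hne T₁, hne T₂] with t ht1 ht2
      rcases lt_or_gt_of_ne ht1 with hlt | hgt
      · rw [Set.indicator_of_notMem (fun h => absurd h.1 hlt.not_gt)]
        refine tendsto_const_nhds.congr' ?_
        filter_upwards [eventually_gt_atTop 0, eventually_gt_atTop (T₁ - t)⁻¹] with u hu hu'
        rw [if_neg]
        intro h
        have hc := (Finset.mem_Ico.1 h).1
        have h0 : 0 < u * t := Nat.ceil_pos.1 (hpos u hu _ h).1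
        have h3 := Nat.ceil_lt_add_one h0.le
        have h4 := Nat.le_ceil (u * T₁)
        have h5 : (⌈u * T₁⌉₊ : ℝ) ≤ ⌈u * t⌉₊ := by exact_mod_cast hc
        have h6 := (inv_lt_iff_one_lt_mul₀' (sub_pos.2 hlt)).1 hu'
        nlinarith
      · rcases lt_or_gt_of_ne ht2 with hlt2 | hgt2
        · rw [Set.indicator_of_mem (show t ∈ Set.Ioc T₁ T₂ from ⟨hgt, hlt2.le⟩)]
          refine (hlim t ⟨h1.trans hgt, hlt2.trans h2⟩).congr' ?_
          filter_upwards [eventually_gt_atTop 0, eventually_gt_atTop (T₂ - t)⁻¹] with u hu hu'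
          rw [if_pos]
          refine Finset.mem_Ico.2 ⟨Nat.ceil_mono (by gcongr), Nat.lt_succ_of_le (Nat.le_floor ?_)⟩
          have h3 := Nat.ceil_lt_add_one (a := u * t) (mul_pos hu (h1.trans hgt)).le
          have h6 := (inv_lt_iff_one_lt_mul₀' (sub_pos.2 hlt2)).1 hu'
          nlinarith
        · rw [Set.indicator_of_notMem (fun h => absurd h.2 hgt2.not_ge)]
          refine tendsto_const_nhds.congr' ?_
          filter_upwards [eventually_gt_atTop 0] with u hu
          rw [if_neg]
          intro h
          have hc := Nat.lt_succ_iff.1 (Finset.mem_Ico.1 h).2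
          have h3 := (Nat.le_floor_iff (by nlinarith)).1 hc
          have h4 := Nat.le_ceil (u * t)
          nlinarith
  rw [intervalIntegral.integral_of_le h12.le, ← integral_indicator measurableSet_Ioc]
  refine key.congr' ?_
  filter_upwards [eventually_gt_atTop 0] with u hu using hsum u hu

/-- A two sided sandwich with vanishing error identifies the limit as a Cesàro mean. -/
theorem tendsto_of_cesaro_sandwich {P : ℝ → ℝ} {R : ℕ → ℝ → ℝ} {I δ : ℕ → ℝ} {L : ℝ}
    (hδ : Tendsto δ atTop (nhds 0)) (hR : ∀ m, Tendsto (R m) atTop (nhds (I m)))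
    (hU : ∀ m, ∀ᶠ u in atTop, P u ≤ R m u + (m + 1 : ℕ) / u)
    (hL : ∀ m, ∀ᶠ u in atTop, R m u ≤ P u + δ m)
    (hI : Tendsto (fun N : ℕ => (N : ℝ)⁻¹ * ∑ m ∈ Finset.range N, I m) atTop (nhds L)) :
    Tendsto P atTop (nhds L) := by
  have hU' : ∀ m, Tendsto (fun u => R m u + (m + 1 : ℕ) / u) atTop (nhds (I m)) := fun m => by
    simpa using (hR m).add (tendsto_const_nhds.div_atTop tendsto_id)
  have hmm : ∀ m m', I m ≤ I m' + δ m := fun m m' =>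
    le_of_tendsto_of_tendsto (hR m) ((hU' m').add_const (δ m)) (by
      filter_upwards [hU m', hL m] with u h1 h2
      linarith)
  have hlow : ∀ m, L ≤ I m := by
    intro m
    have hces : Tendsto (fun N : ℕ => (N : ℝ)⁻¹ * ∑ m' ∈ Finset.range N, (I m + δ m')) atTop
        (nhds (I m)) := by
      have := (hδ.const_add (I m)).cesaro
      simpa using this
    refine le_of_tendsto_of_tendsto hI hces (.of_forall fun N => ?_)
    exact mul_le_mul_of_nonneg_left (Finset.sum_le_sum fun m' _ => hmm m' m) (by positivity)
  have hupp : ∀ m, I m ≤ L + δ m := by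
    intro m
    refine ge_of_tendsto (hI.add_const (δ m)) ?_
    filter_upwards [eventually_gt_atTop 0] with N hN
    have hN' : (N : ℝ) ≠ 0 := by positivity
    have : ∑ _m' ∈ Finset.range N, (I m - δ m) ≤ ∑ m' ∈ Finset.range N, I m' :=
      Finset.sum_le_sum fun m' _ => by linarith [hmm m m']
    rw [Finset.sum_const, Finset.card_range, nsmul_eq_mul] at this
    have h2 := mul_le_mul_of_nonneg_left this (by positivity : (0 : ℝ) ≤ (N : ℝ)⁻¹)
    rw [inv_mul_cancel_left₀ hN'] at h2
    linarith
  refine tendsto_order.2 ⟨fun c hc => ?_, fun c hc => ?_⟩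
  · obtain ⟨m, hm⟩ := (hδ.eventually_lt_const (sub_pos.2 hc)).exists
    filter_upwards [hL m, (hR m).eventually_const_lt (show L - (L - c - δ m) < I m by
      linarith [hlow m])] with u h1 h2
    linarith
  · obtain ⟨m, hm⟩ := (hδ.eventually_lt_const (sub_pos.2 hc)).exists
    filter_upwards [hU m, (hU' m).eventually_lt_const (show I m < c by linarith [hupp m])]
      with u h1 h2
    linarith

lemma tendsto_cesaro_integral_stayProb {H : ℝ → ℝ} (hH : ∀ b : ℝ, 0 < b →
      Tendsto (fun N : ℕ => (N : ℝ)⁻¹ * ∑ m ∈ Finset.range N, stayProb b m) atTop (nhds (H b)))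
    {T₁ T₂ : ℝ} (h1 : 0 < T₁) (h12 : T₁ < T₂) (h2 : T₂ < 1) :
    Tendsto (fun N : ℕ => (N : ℝ)⁻¹ * ∑ m ∈ Finset.range N, ∫ t in T₁..T₂, ((2 * π)⁻¹ *
      ∫ φ in (-π)..π, stayProb ((cos φ ^ 2 + 1 / 2 * sin φ ^ 2) / (t * (1 - t))) m)) atTop
      (nhds ((2 * π)⁻¹ * ∫ φ in (0 : ℝ)..(2 * π), ∫ t in T₁..T₂,
        H ((cos φ ^ 2 + 1 / 2 * sin φ ^ 2) / (t * (1 - t))))) := by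
  set q : ℝ × ℝ → ℝ := fun p => (cos p.1 ^ 2 + 1 / 2 * sin p.1 ^ 2) / (p.2 * (1 - p.2)) with hq
  have hqm : Measurable q := by fun_prop
  set ν : Measure (ℝ × ℝ) := (volume.restrict (Set.Ioc 0 (2 * π))).prod
    (volume.restrict (Set.Ioc T₁ T₂)) with hν
  have hpos : ∀ᵐ p ∂ν, 0 < q p := by
    rw [hν, Measure.prod_restrict]
    refine ae_restrict_of_forall_mem (measurableSet_Ioc.prod measurableSet_Ioc) fun p hp => ?_
    have ha : 0 < p.2 := h1.trans hp.2.1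
    have hb : 0 < 1 - p.2 := sub_pos.2 (hp.2.2.trans_lt h2)
    have hc := sin_sq_add_cos_sq p.1
    exact div_pos (by nlinarith [sq_nonneg (cos p.1)]) (mul_pos ha hb)
  have hsm : ∀ m, Measurable fun p => stayProb (q p) m := fun m => (measurable_stayProb m).comp hqm
  have hsi : ∀ m, Integrable (fun p => stayProb (q p) m) ν := fun m =>
    Integrable.of_bound (hsm m).aestronglyMeasurable 1 (ae_of_all _ fun p => by
      rw [norm_of_nonneg (stayProb_nonneg _ _)]
      exact stayProb_le_one _ _)
  have hI : ∀ m, ∫ t in T₁..T₂, ((2 * π)⁻¹ * ∫ φ in (-π)..π, stayProb (q (φ, t)) m) =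
      (2 * π)⁻¹ * ∫ p, stayProb (q p) m ∂ν := by
    intro m
    rw [intervalIntegral.integral_const_mul, hν, integral_prod_symm _ (hsi m),
      intervalIntegral.integral_of_le h12.le]
    congr 1
    refine integral_congr_ae (ae_of_all _ fun t => ?_)
    have hper : Function.Periodic (fun φ => stayProb (q (φ, t)) m) (2 * π) := fun φ => by
      simp [hq]
    have := hper.intervalIntegral_add_eq (-π) 0
    rw [show -π + 2 * π = π by ring, zero_add] at this
    change ∫ φ in (-π)..π, stayProb (q (φ, t)) m = _
    rw [this, intervalIntegral.integral_of_le two_pi_pos.le]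
  have hlim : ∀ᵐ p ∂ν, Tendsto (fun N : ℕ => (N : ℝ)⁻¹ * ∑ m ∈ Finset.range N, stayProb (q p) m)
      atTop (nhds (H (q p))) := hpos.mono fun p hp => hH _ hp
  have hmeas : ∀ N : ℕ, AEStronglyMeasurable
      (fun p => (N : ℝ)⁻¹ * ∑ m ∈ Finset.range N, stayProb (q p) m) ν := fun N =>
    (measurable_const.mul (Finset.measurable_fun_sum _ fun m _ => hsm m)).aestronglyMeasurable
  have hbd : ∀ (N : ℕ) p, ‖(N : ℝ)⁻¹ * ∑ m ∈ Finset.range N, stayProb (q p) m‖ ≤ 1 := by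
    intro N p
    rw [norm_of_nonneg (mul_nonneg (by positivity) (Finset.sum_nonneg fun m _ =>
      stayProb_nonneg _ _))]
    refine (mul_le_mul_of_nonneg_left (Finset.sum_le_card_nsmul _ _ 1 fun m _ =>
      stayProb_le_one _ _) (by positivity)).trans ?_
    simpa using inv_mul_le_one (a := (N : ℝ))
  have hHm : AEStronglyMeasurable (fun p => H (q p)) ν :=
    aestronglyMeasurable_of_tendsto_ae atTop hmeas hlim
  have hHi : Integrable (fun p => H (q p)) ν := Integrable.of_bound hHm 1 (by
    filter_upwards [hlim] with p hp
    exact le_of_tendsto hp.norm (.of_forall fun N => hbd N p))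
  have key := (tendsto_integral_of_dominated_convergence (fun _ => 1) hmeas
    (integrable_const _) (fun N => ae_of_all _ (hbd N)) hlim).const_mul (2 * π)⁻¹
  rw [hν, integral_prod _ hHi] at key
  rw [intervalIntegral.integral_of_le two_pi_pos.le]
  simp only [intervalIntegral.integral_of_le h12.le] at hI ⊢
  refine key.congr fun N => ?_
  rw [integral_const_mul, integral_finsetSum _ fun m _ => hsi m]
  simp only [hq] at hI
  simp only [hI, hq, ← Finset.mul_sum]
  ring

/-- The indices of the grid points `k / u` in `[T₁, T₂]`. -/
noncomputable def gridIdx (T₁ T₂ u : ℝ) : Finset ℕ := Finset.Ico ⌈u * T₁⌉₊ (⌊u * T₂⌋₊ + 1)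

lemma mem_gridIdx {T₁ T₂ u : ℝ} (h2 : 0 ≤ T₂) (hu : 0 < u) {k : ℕ} :
    k ∈ gridIdx T₁ T₂ u ↔ (k : ℝ) / u ∈ Set.Icc T₁ T₂ := by
  rw [gridIdx, Finset.mem_Ico, Nat.lt_succ_iff, Nat.ceil_le, Nat.le_floor_iff (by positivity),
    Set.mem_Icc, le_div_iff₀ hu, div_le_iff₀ hu, mul_comm u, mul_comm u]

/-- The normalized probability that the scan statistic exceeds the level. -/
noncomputable def scanRatio {Ω : Type*} [MeasurableSpace Ω] (μ : Measure Ω) (X₁ X₂ : ℝ → Ω → ℝ)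
    (T₁ T₂ u : ℝ) : ℝ :=
  u⁻¹ * (exp (u / 2) * μ.real (⋃ k ∈ gridIdx T₁ T₂ u, exceed X₁ X₂ u k))

namespace IsScanPair

variable {Ω : Type*} [MeasurableSpace Ω] {μ : Measure Ω} [IsProbabilityMeasure μ]
variable {X₁ X₂ : ℝ → Ω → ℝ} {T₁ T₂ : ℝ}

theorem tendsto_sum_lastIn (hX : IsScanPair μ X₁ X₂) (h1 : 0 < T₁) (h12 : T₁ < T₂) (h2 : T₂ < 1)
    (m : ℕ) : Tendsto (fun u => u⁻¹ * ∑ k ∈ gridIdx T₁ T₂ u,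
      exp (u / 2) * μ.real (lastIn (exceed X₁ X₂ u) (m + 1) k)) atTop
      (nhds (∫ t in T₁..T₂, ((2 * π)⁻¹ * ∫ φ in (-π)..π,
        stayProb ((cos φ ^ 2 + 1 / 2 * sin φ ^ 2) / (t * (1 - t))) m))) := by
  refine tendsto_sum_grid h1 h12 h2 (f := fun u k => exp (u / 2) *
    μ.real (lastIn (exceed X₁ X₂ u) (m + 1) k)) (fun u k hk hu => ?_)
    fun t ht => hX.tendsto_lastIn_exceed ht m
  rw [abs_of_nonneg (by positivity)]
  calc exp (u / 2) * μ.real (lastIn (exceed X₁ X₂ u) (m + 1) k)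
      ≤ exp (u / 2) * μ.real (exceed X₁ X₂ u k) := by
        gcongr
        exacts [measure_ne_top _ _, lastIn_subset _ _ _]
    _ = 1 := by rw [hX.measureReal_exceed hk hu, ← exp_add]; ring_nf; exact exp_zero

lemma scanRatio_le (hX : IsScanPair μ X₁ X₂) (h0 : 0 ≤ T₂) (h2 : T₂ < 1) (w : ℕ) :
    ∀ᶠ u in atTop, scanRatio μ X₁ X₂ T₁ T₂ u ≤ u⁻¹ * ∑ k ∈ gridIdx T₁ T₂ u,
      exp (u / 2) * μ.real (lastIn (exceed X₁ X₂ u) w k) + w / u := by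
  filter_upwards [eventually_gt_atTop 0, eventually_gt_atTop ((w + 1) / (1 - T₂))] with u hu hu'
  rw [div_lt_iff₀ (sub_pos.2 h2)] at hu'
  have h := measureReal_biUnion_le_lastIn (μ := μ) (exceed X₁ X₂ u) w ⌈u * T₁⌉₊ (⌊u * T₂⌋₊ + 1)
  have hsum : ∑ k ∈ Finset.Ico (⌊u * T₂⌋₊ + 1) (⌊u * T₂⌋₊ + 1 + w), μ.real (exceed X₁ X₂ u k) ≤
      w * exp (-u / 2) := by
    have := Finset.sum_le_card_nsmul (Finset.Ico (⌊u * T₂⌋₊ + 1) (⌊u * T₂⌋₊ + 1 + w))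
      (fun k => μ.real (exceed X₁ X₂ u k)) (exp (-u / 2)) fun k hk => by
        rw [Finset.mem_Ico] at hk
        refine (hX.measureReal_exceed (by lia) ?_).le
        have hk2 : (k : ℝ) ≤ ⌊u * T₂⌋₊ + w := by
          have : k ≤ ⌊u * T₂⌋₊ + w := by lia
          exact_mod_cast this
        have := Nat.floor_le (mul_nonneg hu.le h0)
        nlinarith
    simpa using this
  unfold scanRatio
  rw [← Finset.mul_sum, div_eq_inv_mul (w : ℝ), ← mul_add]
  have h3 := mul_le_mul_of_nonneg_left (h.trans (add_le_add_right hsum _)) (exp_pos (u / 2)).le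
  rw [mul_add, mul_left_comm _ (w : ℝ), ← exp_add, neg_div, add_neg_cancel, exp_zero, mul_one] at h3
  gcongr
  exact h3

lemma sum_lastIn_le_scanRatio (hX : IsScanPair μ X₁ X₂) (h1 : 0 < T₁) (h12 : T₁ < T₂)
    (h2 : T₂ < 1) (w : ℕ) :
    ∀ᶠ u in atTop, u⁻¹ * ∑ k ∈ gridIdx T₁ T₂ u,
      exp (u / 2) * μ.real (lastIn (exceed X₁ X₂ u) w k) ≤
      scanRatio μ X₁ X₂ T₁ T₂ u + 2 * (exp (-1 / 96) ^ (w + 1) / (1 - exp (-1 / 96))) := by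
  filter_upwards [eventually_gt_atTop 0] with u hu
  have hr1 : exp (-1 / 96) < 1 := exp_lt_one_iff.2 (by norm_num)
  have hb : ((⌊u * T₂⌋₊ : ℕ) : ℝ) ≤ u * T₂ := Nat.floor_le (by nlinarith)
  have ha : 0 < ⌈u * T₁⌉₊ := Nat.ceil_pos.2 (by positivity)
  have h := sum_lastIn_le_of_inter_le (μ := μ) (E := exceed X₁ X₂ u) (hX.measurableSet_exceed u)
    (exp_pos (-1 / 96)).le hr1 (c := 2 * exp (-u / 2)) (by positivity) w ⌈u * T₁⌉₊ (⌊u * T₂⌋₊ + 1)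
    fun k l hk hkl hl => by
      have hl' : (l : ℝ) ≤ ⌊u * T₂⌋₊ := by exact_mod_cast Nat.lt_succ_iff.1 hl
      refine (hX.measureReal_exceed_inter (ha.trans_le hk) hkl (by nlinarith)).trans_eq ?_
      rw [← exp_nat_mul, Nat.cast_sub hkl.le]
      ring_nf
  have hn : ((⌊u * T₂⌋₊ + 1 - ⌈u * T₁⌉₊ : ℕ) : ℝ) ≤ u := by
    have : ((⌊u * T₂⌋₊ + 1 - ⌈u * T₁⌉₊ : ℕ) : ℝ) ≤ ⌊u * T₂⌋₊ := by
      exact_mod_cast (by lia : ⌊u * T₂⌋₊ + 1 - ⌈u * T₁⌉₊ ≤ ⌊u * T₂⌋₊)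
    nlinarith
  set ε := exp (-1 / 96) ^ (w + 1) / (1 - exp (-1 / 96)) with hε
  have hε0 : 0 ≤ ε := div_nonneg (by positivity) (sub_pos.2 hr1).le
  have h4 : ((⌊u * T₂⌋₊ + 1 - ⌈u * T₁⌉₊ : ℕ) : ℝ) * (2 * exp (-u / 2) * ε) ≤
      u * (2 * exp (-u / 2) * ε) := by gcongr
  have h5 := mul_le_mul_of_nonneg_left (h.trans (add_le_add_right h4 _))
    (by positivity : 0 ≤ u⁻¹ * exp (u / 2))
  have h6 : exp (u / 2) * exp (-u / 2) = 1 := by rw [← exp_add, neg_div, add_neg_cancel, exp_zero]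
  unfold scanRatio
  rw [← Finset.mul_sum, ← mul_assoc, ← mul_assoc]
  refine h5.trans_eq ?_
  rw [mul_add]
  congr 1
  calc _ = u⁻¹ * u * (exp (u / 2) * exp (-u / 2)) * (2 * ε) := by ring
    _ = _ := by rw [h6, inv_mul_cancel₀ hu.ne', one_mul, one_mul]

theorem tendsto_scanRatio (hX : IsScanPair μ X₁ X₂) (h1 : 0 < T₁) (h12 : T₁ < T₂)
    (h2 : T₂ < 1) {H : ℝ → ℝ} (hH : ∀ b : ℝ, 0 < b →
      Tendsto (fun N : ℕ => (N : ℝ)⁻¹ * ∑ m ∈ Finset.range N, stayProb b m) atTop (nhds (H b))) :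
    Tendsto (scanRatio μ X₁ X₂ T₁ T₂) atTop
      (nhds ((2 * π)⁻¹ * ∫ φ in (0 : ℝ)..(2 * π), ∫ t in T₁..T₂,
        H ((cos φ ^ 2 + 1 / 2 * sin φ ^ 2) / (t * (1 - t))))) := by
  refine tendsto_of_cesaro_sandwich
    (δ := fun m => 2 * (exp (-1 / 96) ^ (m + 1 + 1) / (1 - exp (-1 / 96)))) ?_
    (fun m => hX.tendsto_sum_lastIn h1 h12 h2 m)
    (fun m => hX.scanRatio_le (h1.trans h12).le h2 (m + 1))
    (fun m => hX.sum_lastIn_le_scanRatio h1 h12 h2 (m + 1))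
    (tendsto_cesaro_integral_stayProb hH h1 h12 h2)
  have h := tendsto_pow_atTop_nhds_zero_of_lt_one (exp_pos (-1 / 96)).le
    (exp_lt_one_iff.2 (by norm_num : (-1 / 96 : ℝ) < 0))
  have := (((tendsto_add_atTop_iff_nat 2).2 h).div_const (1 - exp (-1 / 96))).const_mul 2
  simpa using this

/-- Thinning the grid gives a lower bound which does not depend on the level. -/
lemma exists_pos_le_scanRatio (hX : IsScanPair μ X₁ X₂) (h1 : 0 < T₁) (h12 : T₁ < T₂)
    (h2 : T₂ < 1) : ∃ c > 0, ∀ᶠ u in atTop, c ≤ scanRatio μ X₁ X₂ T₁ T₂ u := by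
  have hr1 : exp (-1 / 96) < 1 := exp_lt_one_iff.2 (by norm_num)
  have hr0 := exp_pos (-1 / 96)
  obtain ⟨N, hN⟩ := exists_pow_lt_of_lt_one (by norm_num : (0 : ℝ) < 1 / 5) hr1
  have hN0 : 0 < N := by
    rcases Nat.eq_zero_or_pos N with rfl | h
    · norm_num at hN
    · exact h
  have hN0' : (0 : ℝ) < N := by exact_mod_cast hN0
  set r := exp (-1 / 96) ^ N with hr
  have hr0' : 0 < r := pow_pos hr0 _
  have hT : 0 < T₂ - T₁ := sub_pos.2 h12
  refine ⟨(T₂ - T₁) / (4 * N), by positivity, ?_⟩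
  filter_upwards [eventually_gt_atTop 0, eventually_gt_atTop (2 * N / (T₂ - T₁))] with u hu hu'
  rw [div_lt_iff₀ hT] at hu'
  set a := ⌈u * T₁⌉₊ with ha
  set n := ⌊u * (T₂ - T₁) / N⌋₊ with hn
  have ha0 : 0 < a := Nat.ceil_pos.2 (by positivity)
  have ha1 : (a : ℝ) < u * T₁ + 1 := Nat.ceil_lt_add_one (by positivity)
  have hsub : ∀ i ∈ Finset.Ico 0 n, a + i * N ∈ gridIdx T₁ T₂ u := by
    intro i hi
    have hi : i + 1 ≤ n := (Finset.mem_Ico.1 hi).2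
    have hi' := (Nat.le_floor_iff (by positivity)).1 hi
    rw [le_div_iff₀ hN0'] at hi'
    refine Finset.mem_Ico.2 ⟨by lia, Nat.lt_succ_of_le (Nat.le_floor ?_)⟩
    push_cast at hi' ⊢
    have : (1 : ℝ) ≤ N := by exact_mod_cast hN0
    nlinarith
  have hlt : ∀ k ∈ gridIdx T₁ T₂ u, (k : ℝ) < u := fun k hk => by
    have := (Nat.le_floor_iff (by nlinarith)).1 (Nat.lt_succ_iff.1 (Finset.mem_Ico.1 hk).2)
    nlinarith
  have h := sum_lastIn_le_of_inter_le (μ := μ) (E := fun i => exceed X₁ X₂ u (a + i * N))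
    (fun i => hX.measurableSet_exceed u _) hr0'.le (by linarith) (c := 2 * exp (-u / 2))
    (by positivity) 0 0 n fun k l _ hkl hl => by
      refine (hX.measureReal_exceed_inter (by lia) (by gcongr)
        (hlt _ (hsub l (Finset.mem_Ico.2 ⟨l.zero_le, hl⟩)))).trans_eq ?_
      rw [hr, ← pow_mul, ← exp_nat_mul, Nat.cast_mul, Nat.cast_sub hkl.le]
      push_cast
      ring_nf
  have hone : ∑ k ∈ Finset.Ico 0 n,
      μ.real (lastIn (fun i => exceed X₁ X₂ u (a + i * N)) 0 k) = n * exp (-u / 2) := by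
    rw [Finset.sum_congr rfl fun k hk => show _ = exp (-u / 2) by
      rw [← hX.measureReal_exceed (k := a + k * N) (by lia) (hlt _ (hsub k hk))]
      simp [lastIn]]
    simp
  have hU : μ.real (⋃ k ∈ Finset.Ico 0 n, exceed X₁ X₂ u (a + k * N)) ≤
      μ.real (⋃ k ∈ gridIdx T₁ T₂ u, exceed X₁ X₂ u k) :=
    measureReal_mono (Set.iUnion₂_subset fun k hk => Set.subset_biUnion_of_mem
      (u := fun k => exceed X₁ X₂ u k) (hsub k hk)) (measure_ne_top _ _)
  have hε : r ^ (0 + 1) / (1 - r) ≤ 1 / 4 := by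
    rw [div_le_iff₀ (by linarith)]
    linarith
  have hn2 : u * (T₂ - T₁) / N / 2 ≤ n := by
    have h2x : 2 ≤ u * (T₂ - T₁) / N := (le_div_iff₀ hN0').2 hu'.le
    linarith [Nat.lt_floor_add_one (u * (T₂ - T₁) / N)]
  rw [hone, Nat.sub_zero] at h
  have hne : 0 ≤ (n : ℝ) * exp (-u / 2) := by positivity
  have hfin : (n : ℝ) * exp (-u / 2) / 2 ≤ μ.real (⋃ k ∈ gridIdx T₁ T₂ u, exceed X₁ X₂ u k) := by
    nlinarith
  have h6 : exp (u / 2) * exp (-u / 2) = 1 := by rw [← exp_add, neg_div, add_neg_cancel, exp_zero]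
  calc (T₂ - T₁) / (4 * N) = u⁻¹ * (u * (T₂ - T₁) / N / 2) * 2⁻¹ := by field_simp; norm_num
    _ ≤ u⁻¹ * n * 2⁻¹ := by gcongr
    _ = u⁻¹ * (exp (u / 2) * ((n : ℝ) * exp (-u / 2) / 2)) := by
      linear_combination (-u⁻¹ * n / 2) * h6
    _ ≤ scanRatio μ X₁ X₂ T₁ T₂ u := by
      unfold scanRatio
      gcongr

end IsScanPair

lemma lt_sSup_eq_biUnion_exceed {Ω : Type*} (X₁ X₂ : ℝ → Ω → ℝ) {T₁ T₂ u : ℝ} (h1 : 0 < T₁)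
    (h12 : T₁ < T₂) (hu : 1 / (T₂ - T₁) < u) :
    {ω : Ω | sSup ((fun t : ℝ => (X₁ t ω) ^ 2 + (X₂ t ω) ^ 2) ''
      (Set.Icc T₁ T₂ ∩ {x : ℝ | ∃ k : ℤ, x = (k : ℝ) / u})) > u} =
      ⋃ k ∈ gridIdx T₁ T₂ u, exceed X₁ X₂ u k := by
  have hT := sub_pos.2 h12
  have hu0 : 0 < u := (one_div_pos.2 hT).trans hu
  rw [div_lt_iff₀ hT] at hu
  have hset : Set.Icc T₁ T₂ ∩ {x : ℝ | ∃ k : ℤ, x = (k : ℝ) / u} =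
      (fun k : ℕ => (k : ℝ) / u) '' (gridIdx T₁ T₂ u : Set ℕ) := by
    ext x
    simp only [Set.mem_inter_iff, Set.mem_ofPred_eq, Set.mem_image, Finset.mem_coe,
      mem_gridIdx (h1.trans h12).le hu0]
    constructor
    · rintro ⟨hx, k, rfl⟩
      have hk : 0 ≤ k := by
        have := (div_pos_iff_of_pos_right hu0).1 (h1.trans_le hx.1)
        exact_mod_cast this.le
      lift k to ℕ using hk
      exact ⟨k, by simpa using hx, by simp⟩
    · rintro ⟨k, hk, rfl⟩
      exact ⟨hk, k, by simp⟩
  have hne : (gridIdx T₁ T₂ u).Nonempty := by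
    refine ⟨⌈u * T₁⌉₊, (mem_gridIdx (h1.trans h12).le hu0).2 ⟨?_, ?_⟩⟩
    · rw [le_div_iff₀ hu0, mul_comm]
      exact Nat.le_ceil _
    · rw [div_le_iff₀ hu0]
      have := Nat.ceil_lt_add_one (mul_pos hu0 h1).le
      linarith
  ext ω
  rw [hset, Set.mem_ofPred_eq, ← Set.image_comp, gt_iff_lt, lt_csSup_iff
    ((Finset.finite_toSet _).image _).bddAbove (Finset.coe_nonempty.2 hne |>.image _)]
  simp [exceed]

theorem stmt_17 {Ω : Type*} [MeasureSpace Ω] [IsProbabilityMeasure (volume : Measure Ω)]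
    (T₁ T₂ : ℝ) (h1 : 0 < T₁) (h12 : T₁ < T₂) (h2 : T₂ < 1)
    (X₁ X₂ : ℝ → Ω → ℝ)
    (hmeas₁ : ∀ t, Measurable (X₁ t)) (hmeas₂ : ∀ t, Measurable (X₂ t))
    -- X₁, X₂ are independent centered Gaussian processes
    (hgauss : ∀ (m : ℕ) (c₁ c₂ : Fin m → ℝ) (t : Fin m → ℝ), ∃ v : NNReal,
      Measure.map (fun ω => ∑ j, (c₁ j * X₁ (t j) ω + c₂ j * X₂ (t j) ω)) volume =
        gaussianReal 0 v)
    (hindep : IndepFun (fun ω => fun t => X₁ t ω) (fun ω => fun t => X₂ t ω))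
    -- covariance structures on (0,1)
    (hcov₁ : ∀ s t : ℝ, s ∈ Set.Ioo (0:ℝ) 1 → t ∈ Set.Ioo (0:ℝ) 1 →
      ∫ ω, X₁ s ω * X₁ t ω =
        (min s t * (1 - max s t)) / (max s t * (1 - min s t)))
    (hcov₂ : ∀ s t : ℝ, s ∈ Set.Ioo (0:ℝ) 1 → t ∈ Set.Ioo (0:ℝ) 1 →
      ∫ ω, X₂ s ω * X₂ t ω =
        (min s t * (1 - max s t)) /
          Real.sqrt (min s t * (1 - min s t) * (max s t) * (1 - max s t)))
    -- the discrete Pickands constant H₁¹, defined via standard Brownian motion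
    {Ω' : Type*} [MeasureSpace Ω'] [IsProbabilityMeasure (volume : Measure Ω')]
    (B : ℝ → Ω' → ℝ)
    (hgaussB : ∀ (m : ℕ) (c : Fin m → ℝ) (t : Fin m → ℝ), ∃ v : NNReal,
      Measure.map (fun ω => ∑ j, c j * B (t j) ω) volume = gaussianReal 0 v)
    (hcovB : ∀ s t : ℝ, ∫ ω, B s ω * B t ω = (|t| + |s| - |t - s|) / 2)
    (H : ℝ → ℝ)
    (hH : ∀ b : ℝ, 0 < b →
      Tendsto (fun S : ℝ =>
          (∫ ω, sSup ((fun t : ℝ =>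
              Real.exp (Real.sqrt (2 * b) * B t ω - b * |t|)) ''
              (Set.Icc 0 S ∩ {x : ℝ | ∃ k : ℤ, x = (k : ℝ)}))) / S)
        atTop (nhds (H b))) :
    Tendsto (fun u : ℝ =>
        (volume {ω : Ω | sSup ((fun t : ℝ => (X₁ t ω) ^ 2 + (X₂ t ω) ^ 2) ''
            (Set.Icc T₁ T₂ ∩ {x : ℝ | ∃ k : ℤ, x = (k : ℝ) / u})) > u}).toReal /
          (u * Real.exp (-u / 2) / (2 * π) *
            ∫ φ in (0:ℝ)..(2 * π), ∫ t in T₁..T₂,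
              H (((Real.cos φ) ^ 2 + (1 / 2) * (Real.sin φ) ^ 2) / (t * (1 - t)))))
      atTop (nhds 1) := by
  have hX : IsScanPair volume X₁ X₂ :=
    { fst := isTimeChangedBM_odds_sq (fun m c t => by simpa using hgauss m c 0 t) hmeas₁ hcov₁
      snd := isTimeChangedBM_odds (fun m c t => by simpa using hgauss m 0 c t) hmeas₂ hcov₂
      indep := hindep }
  have hlim := hX.tendsto_scanRatio h1 h12 h2 fun b hb =>
    tendsto_cesaro_stayProb hgaussB hcovB hb (hH b hb)
  obtain ⟨c, hc, hle⟩ := hX.exists_pos_le_scanRatio h1 h12 h2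
  have hL := (hc.trans_le (ge_of_tendsto hlim hle)).ne'
  have hdiv := hlim.div tendsto_const_nhds hL
  rw [div_self hL] at hdiv
  refine hdiv.congr' ?_
  filter_upwards [eventually_gt_atTop (1 / (T₂ - T₁)), eventually_gt_atTop 0] with u hu hu0
  rw [lt_sSup_eq_biUnion_exceed X₁ X₂ h1 h12 hu, Pi.div_apply, scanRatio,
    measureReal_def, neg_div, exp_neg]
  have he := (exp_pos (u / 2)).ne'
  have hI := right_ne_zero_of_mul hL
  field_simp
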